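/- arXiv:1106.5116 — 2 statements merged into one kernel-verified Lean document; each statement's English description precedes it below -/
import Mathlib

section
/- Assume ◊. Then there exists a Hausdorff, hereditarily Lindelöf topological space X that is not a D-space and in which, moreover, every singleton {x} is a Gδ set (a countable intersection of open sets); that is, X has countable Ψ-weight. -/
open Ordinal Set

/-- `ω₁` viewed as the set (type) of all countable ordinals. -/
abbrev Omega1 : Type 1 := {o : Ordinal // o < ω₁}

/-- `C ⊆ ω₁` is club: unbounded, and closed under limits of its elements. -/
def IsClubIn (C : Set Omega1) : Prop :=
  (∀ a : Omega1, ∃ c ∈ C, a < c) ∧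
  ∀ a : Omega1, (∃ b, b < a) → (∀ b < a, ∃ c ∈ C, b < c ∧ c < a) → a ∈ C

/-- `S ⊆ ω₁` is stationary: it meets every closed unbounded subset of `ω₁`. -/
def IsStationaryIn (S : Set Omega1) : Prop :=
  ∀ C : Set Omega1, IsClubIn C → (S ∩ C).Nonempty

/-- The diamond principle `◊`: there is a sequence `⟨A α : α < ω₁⟩` with `A α ⊆ α`
such that for every `B ⊆ ω₁` the set `{α | B ∩ α = A α}` is stationary in `ω₁`. -/
def DiamondPrinciple : Prop :=
  ∃ A : Omega1 → Set Omega1,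
    (∀ α : Omega1, A α ⊆ {β | β < α}) ∧
    ∀ B : Set Omega1, IsStationaryIn {α | B ∩ {β | β < α} = A α}

/-- A `T₁` space `X` is a `D`-space if for every open neighbourhood assignment
`x ↦ U x` there is a closed discrete `D ⊆ X` with `⋃ x ∈ D, U x = X`. -/
def IsDSpace (X : Type*) [TopologicalSpace X] : Prop :=
  ∀ U : X → Set X, (∀ x, IsOpen (U x) ∧ x ∈ U x) →
    ∃ D : Set X, IsClosed D ∧ DiscreteTopology D ∧ (⋃ x ∈ D, U x) = Set.univ

namespace Omega1

theorem countable_Iio (a : Omega1) : (Iio a).Countable := by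
  have h : (Iio a.1 : Set Ordinal.{0}).Countable := by
    rw [← Cardinal.le_aleph0_iff_set_countable, Cardinal.mk_Iio_ordinal,
      ← Cardinal.lift_aleph0.{1, 0}, Cardinal.lift_le, ← Order.lt_succ_iff, Cardinal.succ_aleph0,
      ← Cardinal.lt_ord]
    rw [Cardinal.ord_aleph]
    exact a.2
  exact h.preimage_of_injOn (f := Subtype.val) Subtype.val_injective.injOn

theorem exists_forall_lt {ι : Type*} [Countable ι] (f : ι → Omega1) : ∃ b, ∀ i, f i < b := by
  rcases isEmpty_or_nonempty ι with h | h
  · exact ⟨⟨0, Ordinal.omega_pos 1⟩, fun i => (h.false i).elim⟩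
  obtain ⟨e, he⟩ := exists_surjective_nat ι
  have h1 : ∀ n, Order.succ (f (e n)).1 < ω₁ := fun n =>
    (Cardinal.isSuccLimit_omega 1).succ_lt (f (e n)).2
  refine ⟨⟨⨆ n, Order.succ (f (e n)).1, Ordinal.iSup_lt_omega_one h1⟩, fun i => ?_⟩
  obtain ⟨n, rfl⟩ := he i
  exact (Order.lt_succ (f (e n)).1).trans_le
    (Ordinal.le_iSup (fun n => Order.succ (f (e n)).1) n)

theorem exists_gt_of_countable {S : Set Omega1} (hS : S.Countable) : ∃ b, ∀ s ∈ S, s < b := by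
  have := hS.to_subtype
  obtain ⟨b, hb⟩ := exists_forall_lt (fun s : S => s.1)
  exact ⟨b, fun s hs => hb ⟨s, hs⟩⟩

theorem exists_gt (a : Omega1) : ∃ b, a < b := by
  obtain ⟨b, hb⟩ := exists_forall_lt (fun _ : Unit => a)
  exact ⟨b, hb ()⟩

theorem mk_eq : Cardinal.mk Omega1 = Cardinal.aleph 1 := by
  refine (Cardinal.mk_Iio_ordinal (ω_ 1)).trans ?_
  rw [← Cardinal.ord_aleph, Cardinal.card_ord, Cardinal.lift_aleph]
  simp

/-- Closure points of a function form a club. -/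
theorem isClubIn_closed {S : Type*} (l f : S → Omega1) (hl : ∀ a, {s | l s < a}.Countable)
    (c : Omega1) : IsClubIn {a | c < a ∧ ∀ s, l s < a → f s < a} := by
  constructor
  · intro a
    have hstep : ∀ b : Omega1, ∃ d, b < d ∧ ∀ s, l s < b → f s < d := by
      intro b
      obtain ⟨d, hd⟩ := exists_gt_of_countable ((hl b).image f)
      obtain ⟨e, he⟩ := exists_gt (max b d)
      exact ⟨e, (le_max_left _ _).trans_lt he, fun s hs =>
        (hd _ ⟨s, hs, rfl⟩).trans ((le_max_right _ _).trans_lt he)⟩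
    choose g hg hgf using hstep
    let u : ℕ → Omega1 := fun n => g^[n] (max a c)
    have hu : ∀ n, u (n + 1) = g (u n) := fun n => Function.iterate_succ_apply' _ _ _
    obtain ⟨b, hb, hmin⟩ := wellFounded_lt.has_min {b : Omega1 | ∀ n, u n < b}
      (exists_forall_lt u)
    have h0 : max a c < b := hb 0
    refine ⟨b, ⟨(le_max_right _ _).trans_lt h0, fun s hs => ?_⟩, (le_max_left _ _).trans_lt h0⟩
    have : ∃ n, l s < u n := by
      by_contra! hcon
      refine hmin (l s) (fun n => ?_) hs
      exact (by rw [hu]; exact hg _ : u n < u (n + 1)).trans_le (hcon _)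
    obtain ⟨n, hn⟩ := this
    exact (hgf _ _ hn).trans (hu n ▸ hb (n + 1))
  · rintro a ⟨b, hb⟩ h
    refine ⟨?_, fun s hs => ?_⟩
    · obtain ⟨d, hd, -, hda⟩ := h b hb
      exact hd.1.trans hda
    · obtain ⟨d, hd, hsd, hda⟩ := h _ hs
      exact (hd.2 s hsd).trans hda

end Omega1

/-- The underlying set of the space: each level of `ω₁` carries countably many points. -/
abbrev Pt : Type 1 := Omega1 × ℕ

theorem countable_ofPred_finset {T : Type*} {Z : Set T} (hZ : Z.Countable) :
    {P : Finset T | ∀ b ∈ P, b ∈ Z}.Countable := by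
  refine ((countable_ofPred_finite_subset hZ).preimage_of_injOn
    (f := fun P : Finset T => (P : Set T)) Finset.coe_injective.injOn).mono ?_
  intro P hP
  exact ⟨P.finite_toSet, fun b hb => hP b hb⟩

theorem countable_below (a : Omega1) : {x : Pt | x.1 < a}.Countable :=
  ((Omega1.countable_Iio a).prod (countable_univ (α := ℕ))).mono
    fun x hx => Set.mk_mem_prod hx (mem_univ x.2)

theorem countable_finset_below (a : Omega1) : {R : Finset Pt | ∀ x ∈ R, x.1 < a}.Countable :=
  countable_ofPred_finset (countable_below a)

/-- The height of a finite set of points. -/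
theorem exists_height : ∃ l : Finset Pt → Omega1, (∀ R, ∀ x ∈ R, x.1 ≤ l R) ∧
    ∀ R a b, b < a → (∀ x ∈ R, x.1 < a) → l R < a := by
  let _ : OrderBot Omega1 :=
    { bot := ⟨0, Ordinal.omega_pos 1⟩, bot_le := fun a => bot_le (a := a.1) }
  refine ⟨fun R => R.sup Prod.fst, fun R x hx => Finset.le_sup (f := Prod.fst) hx,
    fun R a b hb h => (Finset.sup_lt_iff (bot_le.trans_lt hb)).2 h⟩

/-- Every family of finite sets, restricted to codes below `a`, equals `A a` for some `a` in any
given club. -/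
def Guesses (A : Omega1 → Set (Finset Pt)) (code : Finset Pt → Omega1) : Prop :=
  ∀ (𝒢 : Set (Finset Pt)) (C : Set Omega1), IsClubIn C →
    ∃ a ∈ C, A a = {G ∈ 𝒢 | code G < a}

theorem exists_guess (hd : DiamondPrinciple) :
    ∃ (A : Omega1 → Set (Finset Pt)) (code : Finset Pt → Omega1), Guesses A code := by
  obtain ⟨A, -, hA⟩ := hd
  have hc : Cardinal.mk (Finset Pt) ≤ Cardinal.mk Omega1 := by
    have : Infinite Omega1 := by
      rw [Cardinal.infinite_iff, Omega1.mk_eq]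
      exact Cardinal.aleph0_le_aleph 1
    rw [Cardinal.mk_finset_of_infinite, Cardinal.mk_prod, Omega1.mk_eq]
    simp
  obtain ⟨⟨code, hcode⟩⟩ := hc
  refine ⟨fun a => {G | code G ∈ A a}, code, fun 𝒢 C hC => ?_⟩
  obtain ⟨a, ha, haC⟩ := hA (code '' 𝒢) C hC
  refine ⟨a, haC, ?_⟩
  ext G
  rw [mem_ofPred_eq] at ha ⊢
  rw [← ha]
  simp [hcode.mem_set_image]

/-- The data attached to a point: its image in the Cantor set, and the set of those points below it
in whose distinguished neighbourhood it lies. -/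
abbrev PtData : Type 1 := (ℕ → Bool) × Set Pt

/-- The distinguished neighbourhood of `x`. -/
def nb (p : Pt → PtData) (x : Pt) : Set Pt := {y | y.1 ≤ x.1 ∨ x ∈ (p y).2}

/-- The part of the guess `A a` consisting of finite sets that lie below level `a`. -/
def guess (A : Omega1 → Set (Finset Pt)) (a : Omega1) : Set (Finset Pt) :=
  {G ∈ A a | ∀ x ∈ G, x.1 < a}

/-- Every neighbourhood of the points with data `q i` at level `a` includes a member of the
guess at `a`. -/
def Accumulates (A : Omega1 → Set (Finset Pt)) (a : Omega1) (p : Pt → PtData) (q : ℕ → PtData) :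
    Prop :=
  ∀ (k : ℕ → ℕ) (F : ℕ → Finset Pt), (∀ i, ∀ x ∈ F i, x.1 < a ∧ x ∈ (q i).2) →
    ∃ G ∈ guess A a, ∀ g ∈ G, ∃ i, (∀ j < k i, (p g).1 j = (q i).1 j) ∧ ∀ x ∈ F i, g ∈ nb p x

/-- `E` includes a member of each guess below `a` at which accumulation was achieved. -/
def Respects (A : Omega1 → Set (Finset Pt)) (a : Omega1) (p : Pt → PtData) (E : Set Pt) : Prop :=
  ∀ b < a, Accumulates A b p (fun i => p (b, i)) → ∃ G ∈ guess A b, ∀ x ∈ G, x ∈ E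

/-- The set of points whose singletons are guessed at `a`. -/
def guessPt (A : Omega1 → Set (Finset Pt)) (a : Omega1) : Set Pt := {x | {x} ∈ A a}

/-- The requirements on the data at level `a`. -/
structure Admissible (A : Omega1 → Set (Finset Pt)) (a : Omega1) (p : Pt → PtData)
    (q : ℕ → PtData) : Prop where
  inj : ∀ i j, (q i).1 = (q j).1 → i = j
  fresh : ∀ x : Pt, x.1 < a → ∀ i, (p x).1 ≠ (q i).1
  respects : ∀ i, Respects A a p (q i).2
  avoids : Respects A a p (guessPt A a)ᶜ → ∃ i, (q i).2 = (guessPt A a)ᶜ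

variable {A : Omega1 → Set (Finset Pt)} {a b : Omega1} {p p₁ : Pt → PtData}

theorem Accumulates.congr {q : ℕ → PtData} (h : ∀ x, x.1 < a → p x = p₁ x)
    (hp : Accumulates A a p q) : Accumulates A a p₁ q := by
  intro k F hF
  obtain ⟨G, hG, hGF⟩ := hp k F hF
  refine ⟨G, hG, fun g hg => ?_⟩
  have := h g (hG.2 g hg)
  unfold nb at hGF ⊢
  simpa [this] using hGF g hg

theorem Respects.congr {E : Set Pt} (h : ∀ x, x.1 < a → p x = p₁ x)
    (hp : Respects A a p E) : Respects A a p₁ E := by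
  intro b hb hacc
  refine hp b hb ?_
  have h1 : (fun i => p (b, i)) = fun i => p₁ (b, i) := funext fun i => h (b, i) hb
  rw [h1]
  exact hacc.congr fun x hx => (h x (hx.trans hb)).symm

theorem Respects.mono {E : Set Pt} (hab : a ≤ b) (hp : Respects A b p E) : Respects A a p E :=
  fun c hc => hp c (hc.trans_le hab)

theorem Admissible.congr {q : ℕ → PtData} (h : ∀ x, x.1 < a → p x = p₁ x)
    (hp : Admissible A a p q) : Admissible A a p₁ q where
  inj := hp.inj
  fresh x hx := h x hx ▸ hp.fresh x hx
  respects i := (hp.respects i).congr h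
  avoids hE := hp.avoids (hE.congr fun x hx => (h x hx).symm)

theorem respects_univ : Respects A a p univ := by
  intro b hb hacc
  obtain ⟨G, hG, -⟩ := hacc (fun _ => 0) (fun _ => ∅) (by simp)
  exact ⟨G, hG, fun x _ => mem_univ x⟩

theorem exists_admissible (A : Omega1 → Set (Finset Pt)) (a : Omega1) (p : Pt → PtData) :
    ∃ q, Admissible A a p q := by
  have hc : ((fun x => (p x).1) '' {x : Pt | x.1 < a}).Countable := (countable_below a).image _
  have hinf : ((fun x => (p x).1) '' {x : Pt | x.1 < a})ᶜ.Infinite := by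
    intro hfin
    have h1 : (univ : Set (ℕ → Bool)).Countable := by
      rw [← union_compl_self ((fun x => (p x).1) '' {x : Pt | x.1 < a})]
      exact hc.union hfin.countable
    have h2 := Cardinal.mk_le_aleph0_iff.2 (countable_univ_iff.1 h1)
    refine (Cardinal.cantor Cardinal.aleph0).not_ge ?_
    simpa using h2
  let e := hinf.natEmbedding
  have hfresh : ∀ x : Pt, x.1 < a → ∀ i, (p x).1 ≠ (e i).1 := fun x hx i hxi =>
    (e i).2 ⟨x, hx, hxi⟩
  have hinj : ∀ i j, (e i).1 = (e j).1 → i = j := fun i j h => e.injective (Subtype.ext h)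
  by_cases h : Respects A a p (guessPt A a)ᶜ
  · exact ⟨fun i => ((e i).1, (guessPt A a)ᶜ), hinj, hfresh, fun _ => h, fun _ => ⟨0, rfl⟩⟩
  · exact ⟨fun i => ((e i).1, univ), hinj, hfresh, fun _ => respects_univ, fun hn => (h hn).elim⟩

/-- There is an assignment of data that is admissible, and accumulates at every possible level. -/
theorem exists_data (A : Omega1 → Set (Finset Pt)) : ∃ p : Pt → PtData,
    ∀ a, Admissible A a p (fun i => p (a, i)) ∧
      ((∃ q, Admissible A a p q ∧ Accumulates A a p q) →
        Accumulates A a p (fun i => p (a, i))) := by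
  have hstep : ∀ (a : Omega1) (p : Pt → PtData), ∃ q, Admissible A a p q ∧
      ((∃ q, Admissible A a p q ∧ Accumulates A a p q) → Accumulates A a p q) := by
    intro a p
    by_cases h : ∃ q, Admissible A a p q ∧ Accumulates A a p q
    · obtain ⟨q, hq⟩ := h
      exact ⟨q, hq.1, fun _ => hq.2⟩
    · obtain ⟨q, hq⟩ := exists_admissible A a p
      exact ⟨q, hq, fun hn => (h hn).elim⟩
  choose step hadm hacc using hstep
  classical
  let ext : (a : Omega1) → ((b : Omega1) → b < a → ℕ → PtData) → Pt → PtData :=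
    fun a f x => if h : x.1 < a then f x.1 h x.2 else default
  let L : Omega1 → ℕ → PtData :=
    (wellFounded_lt (α := Omega1)).fix fun a f => step a (ext a f)
  have hL : ∀ a, L a = step a (ext a fun b _ => L b) := fun a =>
    (wellFounded_lt (α := Omega1)).fix_eq _ a
  let p : Pt → PtData := fun x => L x.1 x.2
  have hp : ∀ a, ∀ x : Pt, x.1 < a → ext a (fun b _ => L b) x = p x := fun a x hx => dif_pos hx
  refine ⟨p, fun a => ?_⟩
  have hpa : (fun i => p (a, i)) = step a (ext a fun b _ => L b) := hL a
  rw [hpa]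
  refine ⟨(hadm _ _).congr (hp a), fun ⟨q, hq, hq'⟩ => ?_⟩
  refine (hacc _ _ ⟨q, hq.congr ?_, hq'.congr ?_⟩).congr (hp a) <;>
  exact fun x hx => (hp a x hx).symm

/-- The properties of the data obtained from `exists_data`. -/
def IsGeneric (A : Omega1 → Set (Finset Pt)) (p : Pt → PtData) : Prop :=
  ∀ a, Admissible A a p (fun i => p (a, i)) ∧
    ((∃ q, Admissible A a p q ∧ Accumulates A a p q) → Accumulates A a p (fun i => p (a, i)))

theorem IsGeneric.injective (hp : IsGeneric A p) : Function.Injective fun x => (p x).1 := by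
  rintro ⟨a, i⟩ ⟨b, j⟩ h
  rcases lt_trichotomy a b with hab | rfl | hab
  · exact ((hp b).1.fresh (a, i) hab j h).elim
  · rw [(hp a).1.inj i j h]
  · exact ((hp a).1.fresh (b, j) hab i h.symm).elim

/-- The points of a finite set above level `a` fit into the requirements for level `a`. -/
theorem IsGeneric.exists_admissible_cover (hp : IsGeneric A p) {h : Finset Pt}
    (hh : ∀ x ∈ h, a ≤ x.1) :
    ∃ q, Admissible A a p q ∧ ∀ g ∈ h, ∃ i, q i = p g := by
  classical
  let Z : Set Pt := ↑h ∪ range fun n : ℕ => ((a, n) : Pt)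
  have hinj : Function.Injective fun n : ℕ => ((a, n) : Pt) := fun m n hmn => by simpa using hmn
  have hZinf : Z.Infinite := (infinite_range_of_injective hinj).mono subset_union_right
  have hZc : Z.Countable := h.countable_toSet.union (countable_range _)
  have hZa : ∀ z ∈ Z, a ≤ z.1 := by
    rintro z (hz | ⟨n, rfl⟩)
    · exact hh z hz
    · exact le_rfl
  have := hZc.to_subtype
  have := hZinf.to_subtype
  obtain ⟨e⟩ := nonempty_equiv_of_countable (α := ℕ) (β := Z)
  obtain ⟨-, ⟨n, rfl⟩, hn⟩ := (infinite_range_of_injective hinj).exists_notMem_finset h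
  obtain ⟨m, hm⟩ := e.surjective ⟨(a, n), Or.inr ⟨n, rfl⟩⟩
  let E : Set Pt := if Respects A a p (guessPt A a)ᶜ then (guessPt A a)ᶜ else univ
  have hE : Respects A a p E := by
    by_cases hr : Respects A a p (guessPt A a)ᶜ
    · simp [E, hr]
    · simp [E, hr, respects_univ]
  refine ⟨fun i => ((p (e i)).1, if i = m then E else (p (e i)).2), ⟨?_, ?_, ?_, ?_⟩, ?_⟩
  · intro i j hij
    exact e.injective (Subtype.ext (hp.injective hij))
  · intro x hx i hxi
    have := hp.injective hxi
    exact (hZa _ (e i).2).not_gt (this ▸ hx)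
  · intro i
    by_cases him : i = m
    · simpa [him] using hE
    · simpa [him] using ((hp (e i).1.1).1.respects (e i).1.2).mono (hZa _ (e i).2)
  · intro hr
    exact ⟨m, by simp [E, hr]⟩
  · intro g hg
    obtain ⟨i, hi⟩ := e.surjective ⟨g, Or.inl hg⟩
    refine ⟨i, ?_⟩
    have him : i ≠ m := by
      rintro rfl
      have hgn : g = (a, n) := congrArg Subtype.val (hi.symm.trans hm)
      rw [hgn] at hg
      exact hn hg
    simp [him, hi]

/-- A condition on a point: a finite part of its Cantor coordinate, and a finite set of
distinguished neighbourhoods to lie in. -/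
abbrev Cond : Type 1 := (Σ k : ℕ, Fin k → Bool) × Finset Pt

/-- The point `z` satisfies the condition `c`. -/
def Cond.Holds (p : Pt → PtData) (c : Cond) (z : Pt) : Prop :=
  (∀ j : Fin c.1.1, (p z).1 j = c.1.2 j) ∧ ∀ x ∈ c.2, z ∈ nb p x

theorem exists_cover_of_unbounded {code : Finset Pt → Omega1} (hA : Guesses A code)
    (hp : IsGeneric A p) {𝒢 : Set (Finset Pt)} (h𝒢 : ∀ c, ∃ G ∈ 𝒢, ∀ x ∈ G, c < x.1) :
    ∃ d, ∃ 𝒢' ⊆ 𝒢, 𝒢'.Countable ∧ ∀ y : Pt, d < y.1 → ∃ G ∈ 𝒢', ∀ x ∈ G, y ∈ nb p x := by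
  classical
  obtain ⟨l, hl, hl'⟩ := exists_height
  have hf : ∀ P : Finset Cond, ∃ b, (∃ G ∈ 𝒢, ∀ g ∈ G, ∃ c ∈ P, c.Holds p g) →
      ∃ G ∈ 𝒢, (∀ g ∈ G, ∃ c ∈ P, c.Holds p g) ∧ code G ≤ b ∧ l G ≤ b := by
    intro P
    by_cases h : ∃ G ∈ 𝒢, ∀ g ∈ G, ∃ c ∈ P, c.Holds p g
    · obtain ⟨G, hG, hGP⟩ := h
      exact ⟨max (code G) (l G), fun _ => ⟨G, hG, hGP, le_max_left _ _, le_max_right _ _⟩⟩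
    · exact ⟨l ∅, fun hn => (h hn).elim⟩
  choose f hf using hf
  have hcount : ∀ a, {P : Finset Cond | l (P.biUnion Prod.snd) < a}.Countable := by
    intro a
    have h1 : {c : Cond | ∀ x ∈ c.2, x.1 < a}.Countable :=
      ((countable_univ (α := Σ k : ℕ, Fin k → Bool)).prod (countable_finset_below a)).mono
        fun c hc => Set.mk_mem_prod (mem_univ c.1) hc
    refine Countable.mono ?_ (countable_ofPred_finset h1)
    intro P hP c hc x hx
    exact (hl _ x (Finset.mem_biUnion.2 ⟨c, hc, hx⟩)).trans_lt hP
  obtain ⟨a, ⟨ha0, ha⟩, haA⟩ := hA 𝒢 _ (Omega1.isClubIn_closed _ f hcount (l ∅))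
  have hsub : guess A a ⊆ 𝒢 := fun G hG => by
    have := hG.1
    rw [haA] at this
    exact this.1
  have hacc : Accumulates A a p fun i => p (a, i) := by
    refine (hp a).2 ?_
    obtain ⟨h, hh𝒢, hh⟩ := h𝒢 a
    obtain ⟨q, hq, hqh⟩ := hp.exists_admissible_cover fun x hx => (hh x hx).le
    refine ⟨q, hq, fun k F hF => ?_⟩
    choose! ι hι using hqh
    let P : Finset Cond := h.image fun g => (⟨k (ι g), fun j => (p g).1 j⟩, F (ι g))
    have hPa : l (P.biUnion Prod.snd) < a := by
      refine hl' _ a _ ha0 fun x hx => ?_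
      simp only [P, Finset.mem_biUnion, Finset.mem_image] at hx
      obtain ⟨c, ⟨g, hg, rfl⟩, hx⟩ := hx
      exact (hF _ x hx).1
    obtain ⟨G, hG, hGP, hGc, hGl⟩ := hf P ⟨h, hh𝒢, fun g hg =>
      ⟨_, Finset.mem_image_of_mem _ hg, fun j => rfl, fun x hx => Or.inr <| by
        have := (hF _ x hx).2
        rwa [hι g hg] at this⟩⟩
    refine ⟨G, ⟨?_, fun x hx => (hl G x hx).trans_lt (hGl.trans_lt (ha P hPa))⟩, fun g hg => ?_⟩
    · rw [haA]
      exact ⟨hG, hGc.trans_lt (ha P hPa)⟩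
    · obtain ⟨c, hc, hc1, hc2⟩ := hGP g hg
      obtain ⟨g', hg', rfl⟩ := Finset.mem_image.1 hc
      exact ⟨ι g', fun j hj => by rw [hι g' hg']; exact hc1 ⟨j, hj⟩, hc2⟩
  refine ⟨a, guess A a, hsub, (countable_finset_below a).mono fun G hG => hG.2, fun y hy => ?_⟩
  obtain ⟨G, hG, hGy⟩ := (hp y.1).1.respects y.2 a hy hacc
  exact ⟨G, hG, fun x hx => Or.inr (hGy x hx)⟩

/-- The hereditary Lindelöf property for intersections of distinguished neighbourhoods. -/
theorem exists_countable_subcover {code : Finset Pt → Omega1} (hA : Guesses A code)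
    (hp : IsGeneric A p) (t : Set Pt) (F : Pt → Finset Pt) :
    ∃ c ⊆ t, c.Countable ∧
      ∀ y ∈ t, (∀ x ∈ F y, y ∈ nb p x) → ∃ z ∈ c, ∀ x ∈ F z, y ∈ nb p x := by
  classical
  obtain ⟨l, hl, hl'⟩ := exists_height
  have hstep : ∀ R : Finset Pt, ∃ d, ∃ c ⊆ t, c.Countable ∧
      ((∃ z ∈ t, R ⊆ F z ∧ ∀ x ∈ F z, x ∉ R → d < x.1) → ∀ y : Pt, d < y.1 →
        (∀ x ∈ R, y ∈ nb p x) → ∃ z ∈ c, ∀ x ∈ F z, y ∈ nb p x) := by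
    intro R
    by_cases h : ∀ d, ∃ z ∈ t, R ⊆ F z ∧ ∀ x ∈ F z, x ∉ R → d < x.1
    · let 𝒢 : Set (Finset Pt) := (fun z => F z \ R) '' {z ∈ t | R ⊆ F z}
      obtain ⟨d, 𝒢', h𝒢', hc, hd⟩ := exists_cover_of_unbounded hA hp (𝒢 := 𝒢) (fun d => by
        obtain ⟨z, hz, hRz, hzd⟩ := h d
        refine ⟨_, ⟨z, ⟨hz, hRz⟩, rfl⟩, fun x hx => ?_⟩
        rw [Finset.mem_sdiff] at hx
        exact hzd x hx.1 hx.2)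
      have : Nonempty Pt := ⟨(d, 0)⟩
      have hex : ∀ G ∈ 𝒢', ∃ z, z ∈ t ∧ F z \ R = G := fun G hG => by
        obtain ⟨z, hz, hzG⟩ := h𝒢' hG
        exact ⟨z, hz.1, hzG⟩
      choose! w hw hwG using hex
      refine ⟨d, w '' 𝒢', ?_, hc.image _, fun _ y hy hyR => ?_⟩
      · rintro - ⟨G, hG, rfl⟩
        exact hw G hG
      · obtain ⟨G, hG, hGy⟩ := hd y hy
        refine ⟨w G, ⟨G, hG, rfl⟩, fun x hx => ?_⟩
        by_cases hxR : x ∈ R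
        · exact hyR x hxR
        · refine hGy x ?_
          rw [← hwG G hG]
          exact Finset.mem_sdiff.2 ⟨hx, hxR⟩
    · push Not at h
      obtain ⟨d, hd⟩ := h
      refine ⟨d, ∅, empty_subset _, countable_empty, ?_⟩
      rintro ⟨z, hz, hRz, hzd⟩
      obtain ⟨x, hx, hxR, hxd⟩ := hd z hz hRz
      exact ((hzd x hx hxR).not_ge hxd).elim
  choose d c hct hcc hdc using hstep
  have hcount : ∀ a, {R : Finset Pt | l R < a}.Countable := fun a =>
    (countable_finset_below a).mono fun R hR x hx => (hl R x hx).trans_lt hR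
  obtain ⟨a, ⟨ha0, ha⟩, -⟩ := (Omega1.isClubIn_closed l d hcount (l ∅)).1 (l ∅)
  let N : Set Pt := {y ∈ t | y.1 < a ∧ ∀ x ∈ F y, y ∈ nb p x}
  refine ⟨N ∪ ⋃ R ∈ {R : Finset Pt | ∀ x ∈ R, x.1 < a}, c R, ?_, ?_, ?_⟩
  · refine union_subset (fun y hy => hy.1) (iUnion₂_subset fun R _ => hct R)
  · exact ((countable_below a).mono fun y hy => hy.2.1).union
      ((countable_finset_below a).biUnion fun R _ => hcc R)
  · intro y hy hyF
    by_cases hya : y.1 < a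
    · exact ⟨y, Or.inl ⟨hy, hya, hyF⟩, hyF⟩
    let R := (F y).filter fun x => x.1 < a
    have hR : ∀ x ∈ R, x.1 < a := fun x hx => (Finset.mem_filter.1 hx).2
    have hda : d R < a := ha R (hl' R a _ ha0 hR)
    obtain ⟨z, hz, hzy⟩ := hdc R ⟨y, hy, Finset.filter_subset _ _, fun x hx hxR =>
      hda.trans_le (not_lt.1 fun hxa => hxR (Finset.mem_filter.2 ⟨hx, hxa⟩))⟩ y
      (hda.trans_le (not_lt.1 hya)) fun x hx => hyF x (Finset.mem_filter.1 hx).1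
    exact ⟨z, Or.inr (mem_iUnion₂.2 ⟨R, hR, hz⟩), hzy⟩

/-- Basic neighbourhoods: the points that agree with `y` on the first `k` Cantor coordinates, and
lie in finitely many distinguished neighbourhoods. -/
def basicNhd (p : Pt → PtData) (y : Pt) (k : ℕ) (F : Finset Pt) : Set Pt :=
  {z | (∀ j < k, (p z).1 j = (p y).1 j) ∧ ∀ x ∈ F, z ∈ nb p x}

/-- The topology generated by the Cantor topology and the distinguished neighbourhoods. -/
@[reducible] def ptTopology (p : Pt → PtData) : TopologicalSpace Pt where
  IsOpen O := ∀ y ∈ O, ∃ k F, (∀ x ∈ F, y ∈ nb p x) ∧ basicNhd p y k F ⊆ O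
  isOpen_univ _ _ := ⟨0, ∅, by simp, subset_univ _⟩
  isOpen_inter O O' h h' y hy := by
    classical
    obtain ⟨k, F, hF, hO⟩ := h y hy.1
    obtain ⟨k', F', hF', hO'⟩ := h' y hy.2
    refine ⟨max k k', F ∪ F', fun x hx => (Finset.mem_union.1 hx).elim (hF x) (hF' x), ?_⟩
    exact fun z hz => ⟨hO ⟨fun j hj => hz.1 j (hj.trans_le (le_max_left _ _)),
      fun x hx => hz.2 x (Finset.mem_union_left _ hx)⟩,
      hO' ⟨fun j hj => hz.1 j (hj.trans_le (le_max_right _ _)),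
      fun x hx => hz.2 x (Finset.mem_union_right _ hx)⟩⟩
  isOpen_sUnion S h y hy := by
    obtain ⟨O, hO, hyO⟩ := hy
    obtain ⟨k, F, hF, hOk⟩ := h O hO y hyO
    exact ⟨k, F, hF, hOk.trans (subset_sUnion_of_mem hO)⟩

theorem isOpen_basicNhd (p : Pt → PtData) (y : Pt) (k : ℕ) (F : Finset Pt) :
    @IsOpen Pt (ptTopology p) (basicNhd p y k F) := fun _ hz =>
  ⟨k, F, hz.2, fun _ hw => ⟨fun j hj => (hw.1 j hj).trans (hz.1 j hj), hw.2⟩⟩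

theorem mem_basicNhd_empty (p : Pt → PtData) (y : Pt) (k : ℕ) : y ∈ basicNhd p y k ∅ :=
  ⟨fun _ _ => rfl, by simp⟩

theorem isOpen_nb (p : Pt → PtData) (x : Pt) : @IsOpen Pt (ptTopology p) (nb p x) := fun _ hy =>
  ⟨0, {x}, by simpa using hy, fun _ hz => hz.2 x (Finset.mem_singleton_self x)⟩

theorem IsGeneric.exists_ne (hp : IsGeneric A p) {x y : Pt} (hxy : x ≠ y) :
    ∃ j, (p x).1 j ≠ (p y).1 j := by
  by_contra! h
  exact hxy (hp.injective (funext h))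

theorem IsGeneric.t2Space (hp : IsGeneric A p) : @T2Space Pt (ptTopology p) := by
  let _ := ptTopology p
  refine ⟨fun x y hxy => ?_⟩
  obtain ⟨j, hj⟩ := hp.exists_ne hxy
  refine ⟨_, _, isOpen_basicNhd p x (j + 1) ∅, isOpen_basicNhd p y (j + 1) ∅,
    mem_basicNhd_empty p x _, mem_basicNhd_empty p y _, disjoint_left.2 fun z hzx hzy => hj ?_⟩
  exact (hzx.1 j j.lt_succ_self).symm.trans (hzy.1 j j.lt_succ_self)

theorem IsGeneric.isGδ_singleton (hp : IsGeneric A p) (x : Pt) :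
    @IsGδ Pt (ptTopology p) {x} := by
  let _ := ptTopology p
  have h : ({x} : Set Pt) = ⋂ k : ℕ, basicNhd p x k ∅ := by
    ext y
    rw [mem_singleton_iff, mem_iInter]
    refine ⟨fun h k => h ▸ mem_basicNhd_empty p y k, fun h => ?_⟩
    by_contra hyx
    obtain ⟨j, hj⟩ := hp.exists_ne hyx
    exact hj ((h (j + 1)).1 j j.lt_succ_self)
  rw [h]
  exact IsGδ.iInter_of_isOpen fun k => isOpen_basicNhd p x k ∅

theorem IsGeneric.hereditarilyLindelofSpace {code : Finset Pt → Omega1} (hA : Guesses A code)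
    (hp : IsGeneric A p) : @HereditarilyLindelofSpace Pt (ptTopology p) := by
  let _ := ptTopology p
  refine ⟨fun t _ => isLindelof_of_countable_subcover fun {ι} U hU htU => ?_⟩
  rcases t.eq_empty_or_nonempty with rfl | ⟨y₀, hy₀⟩
  · exact ⟨∅, countable_empty, empty_subset _⟩
  have : Nonempty ι := ⟨(mem_iUnion.1 (htU hy₀)).choose⟩
  have h : ∀ y : Pt, ∃ k F, y ∈ t →
      (∀ x ∈ F, y ∈ nb p x) ∧ ∃ i, basicNhd p y k F ⊆ U i := by
    intro y
    by_cases hy : y ∈ t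
    · obtain ⟨i, hi⟩ := mem_iUnion.1 (htU hy)
      obtain ⟨k, F, hF, hk⟩ := hU i y hi
      exact ⟨k, F, fun _ => ⟨hF, i, hk⟩⟩
    · exact ⟨0, ∅, fun h => (hy h).elim⟩
  choose k F hF hkF using h
  let s : (Σ k : ℕ, Fin k → Bool) → Set Pt := fun σ =>
    {y ∈ t | k y = σ.1 ∧ ∀ j : Fin σ.1, (p y).1 j = σ.2 j}
  choose c hcs hcc hc using fun σ => exists_countable_subcover hA hp (s σ) F
  have hct : ∀ σ, ∀ z ∈ c σ, z ∈ t := fun σ z hz => (hcs σ hz).1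
  choose! i hi using hkF
  refine ⟨i '' ⋃ σ, c σ, (countable_iUnion hcc).image _, fun y hy => ?_⟩
  let σ : Σ k : ℕ, Fin k → Bool := ⟨k y, fun j => (p y).1 j⟩
  obtain ⟨z, hz, hzy⟩ := hc σ y ⟨hy, rfl, fun j => rfl⟩ (hF y hy)
  refine mem_iUnion₂.2 ⟨i z, ⟨z, mem_iUnion.2 ⟨σ, hz⟩, rfl⟩, hi z (hct σ z hz) ⟨?_, hzy⟩⟩
  obtain ⟨-, hk, hj⟩ := hcs σ hz
  intro j hjz
  exact (hj ⟨j, hk ▸ hjz⟩).symm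

theorem exists_isOpen_inter_subset {X : Type*} [TopologicalSpace X] {D : Set X}
    (hD : IsClosed D) (hD' : DiscreteTopology D) (y : X) :
    ∃ O, IsOpen O ∧ y ∈ O ∧ O ∩ D ⊆ {y} := by
  by_cases hy : y ∈ D
  · obtain ⟨O, hO, hOD⟩ := isOpen_induced_iff.1 (isOpen_discrete ({⟨y, hy⟩} : Set D))
    have h : ∀ z (hz : z ∈ D), z ∈ O ↔ z = y := fun z hz => by
      have : (⟨z, hz⟩ : D) ∈ Subtype.val ⁻¹' O ↔ (⟨z, hz⟩ : D) ∈ ({⟨y, hy⟩} : Set D) := by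
        rw [hOD]
      simpa using this
    exact ⟨O, hO, (h y hy).2 rfl, fun z hz => (h z hz.2).1 hz.1⟩
  · exact ⟨Dᶜ, hD.isOpen_compl, hy, fun z hz => (hz.1 hz.2).elim⟩

theorem IsGeneric.not_isDSpace {code : Finset Pt → Omega1} (hA : Guesses A code)
    (hp : IsGeneric A p) : ¬ @IsDSpace Pt (ptTopology p) := by
  let _ := ptTopology p
  have := hp.hereditarilyLindelofSpace hA
  intro hX
  obtain ⟨D, hD, hD', hcov⟩ := hX (nb p) fun x => ⟨isOpen_nb p x, Or.inl le_rfl⟩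
  have hDc : D.Countable := (HereditarilyLindelofSpace.isLindelof D).countable hD'
  obtain ⟨b, hb⟩ := Omega1.exists_gt_of_countable
    ((hDc.image fun x => x.1).union (hDc.image fun x => code {x}))
  obtain ⟨a, ⟨hba, -⟩, ha⟩ := hA ((fun x => {x}) '' D) _
    (Omega1.isClubIn_closed (S := Empty) (fun s => s.elim) (fun s => s.elim)
      (fun _ => Set.to_countable _) b)
  have hDa : guessPt A a = D := by
    ext x
    unfold guessPt
    rw [mem_ofPred_eq, ha]
    constructor
    · rintro ⟨⟨y, hy, hyx⟩, -⟩
      rwa [← Finset.singleton_injective hyx]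
    · exact fun hx => ⟨⟨x, hx, rfl⟩, (hb _ (Or.inr ⟨x, hx, rfl⟩)).trans hba⟩
  have hresp : Respects A a p (guessPt A a)ᶜ := by
    intro c hc hacc
    choose O hO hcO hOD using fun i => exists_isOpen_inter_subset hD hD' ((c, i) : Pt)
    choose k F hF hkF using fun i => hO i (c, i) (hcO i)
    classical
    obtain ⟨G, hG, hGF⟩ := hacc k (fun i => (F i).filter fun x => x.1 < c) fun i x hx => by
      rw [Finset.mem_filter] at hx
      exact ⟨hx.2, (hF i x hx.1).resolve_left hx.2.not_ge⟩
    refine ⟨G, hG, fun x hx hxD => ?_⟩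
    rw [hDa] at hxD
    obtain ⟨i, hi1, hi2⟩ := hGF x hx
    have hxc : x.1 < c := hG.2 x hx
    have hxO : x ∈ O i := hkF i ⟨hi1, fun z hz => by
      by_cases hzc : z.1 < c
      · exact hi2 z (Finset.mem_filter.2 ⟨hz, hzc⟩)
      · exact Or.inl (hxc.le.trans (not_lt.1 hzc))⟩
    have hxi : x = (c, i) := hOD i ⟨hxO, hxD⟩
    rw [hxi] at hxc
    exact lt_irrefl c hxc
  obtain ⟨i, hi⟩ := (hp a).1.avoids hresp
  obtain ⟨x, hx, hxa⟩ := mem_iUnion₂.1 (hcov ▸ mem_univ ((a, i) : Pt))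
  rcases hxa with hle | hmem
  · exact ((hb _ (Or.inl ⟨x, hx, rfl⟩)).trans hba).not_ge hle
  · have hxc : x ∈ (guessPt A a)ᶜ := hi ▸ hmem
    rw [hDa] at hxc
    exact hxc hx

/-- Assuming `◊`, there is a Hausdorff hereditarily Lindelöf space that is not a
`D`-space and in which every singleton is a `Gδ` set (countable Ψ-weight). -/
theorem statement4 (hd : DiamondPrinciple) :
    ∃ (X : Type 1) (τ : TopologicalSpace X),
      @T2Space X τ ∧ @HereditarilyLindelofSpace X τ ∧ ¬ @IsDSpace X τ ∧
      ∀ x : X, @IsGδ X τ {x} := by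
  obtain ⟨A, code, hA⟩ := exists_guess hd
  obtain ⟨p, hp⟩ : ∃ p, IsGeneric A p := exists_data A
  exact ⟨Pt, ptTopology p, hp.t2Space, hp.hereditarilyLindelofSpace hA, hp.not_isDSpace hA,
    hp.isGδ_singleton⟩
end

section
/- Assume ◊. Then there exists a Hausdorff, hereditarily Lindelöf topological space X that is not a D-space and such that every subspace of X is an (ε)-space, i.e. for every subspace Y of X, every ω-cover of Y by sets open in Y has a countable subfamily which is still an ω-cover of Y. -/
open Ordinal Set

/-- `X` is an `(ε)`-space: every ω-cover of `X` by open sets (a family such that every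
finite subset of `X` is contained in one of its members) has a countable subfamily that
is still an ω-cover. -/
def IsEpsilonSpace (X : Type*) [TopologicalSpace X] : Prop :=
  ∀ 𝒰 : Set (Set X), (∀ U ∈ 𝒰, IsOpen U) → (∀ K : Finset X, ∃ U ∈ 𝒰, (K : Set X) ⊆ U) →
    ∃ 𝒱 ⊆ 𝒰, 𝒱.Countable ∧ ∀ K : Finset X, ∃ U ∈ 𝒱, (K : Set X) ⊆ U

/-! ### Countable ordinals -/

theorem Omega1.countable_Iio_s5 (a : Omega1) : (Set.Iio a).Countable := by
  have h : (Set.Iio a.1).Countable := by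
    rw [← Cardinal.le_aleph0_iff_set_countable, Cardinal.mk_Iio_ordinal,
      ← Cardinal.lift_aleph0.{1, 0},
      Cardinal.lift_le, ← Order.lt_succ_iff, Cardinal.succ_aleph0, ← Cardinal.lt_ord,
      Cardinal.ord_aleph]
    exact a.2
  exact (h.preimage Subtype.val_injective).mono fun b hb => hb

theorem Omega1.exists_gt_of_countable_s5 {s : Set Omega1} (hs : s.Countable) :
    ∃ a, ∀ x ∈ s, x < a := by
  have := hs.to_subtype
  have h : (⨆ x : s, Order.succ x.1.1) < ω₁ := by
    apply Ordinal.iSup_lt_omega_one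
    intro x
    exact (Cardinal.isSuccLimit_omega 1).succ_lt x.1.2
  refine ⟨⟨_, h⟩, fun x hx => ?_⟩
  have : Order.succ x.1 ≤ ⨆ x : s, Order.succ x.1.1 :=
    Ordinal.le_iSup (fun x : s => Order.succ x.1.1) ⟨x, hx⟩
  exact (Order.lt_succ x.1).trans_le this

instance : Nonempty Omega1 := ⟨⟨0, Ordinal.omega_pos 1⟩⟩

instance : NoMaxOrder Omega1 :=
  ⟨fun a => by
    obtain ⟨b, hb⟩ := Omega1.exists_gt_of_countable_s5 (Set.countable_singleton a)
    exact ⟨b, hb a rfl⟩⟩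

theorem Omega1.countable_Iic (a : Omega1) : (Set.Iic a).Countable := by
  obtain ⟨b, hb⟩ := exists_gt a
  exact (Omega1.countable_Iio_s5 b).mono fun x hx => lt_of_le_of_lt hx hb

theorem Omega1.not_countable_univ : ¬ (Set.univ : Set Omega1).Countable := fun h => by
  obtain ⟨a, ha⟩ := Omega1.exists_gt_of_countable_s5 h
  exact lt_irrefl a (ha a trivial)

theorem Set.exists_not_countable_fiber {ι T : Type*} [Countable T] {S : Set ι}
    (hS : ¬ S.Countable) (f : ι → T) : ∃ t, ¬ {i ∈ S | f i = t}.Countable := by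
  by_contra! h
  refine hS ((Set.countable_iUnion h).mono fun i hi => ?_)
  exact Set.mem_iUnion.2 ⟨f i, hi, rfl⟩

theorem Set.exists_not_countable_of_forall_exists {ι T : Type*} {S : Set ι} {s : Set T}
    (hs : s.Countable) (hS : ¬ S.Countable) (r : ι → T → Prop) (h : ∀ i ∈ S, ∃ t ∈ s, r i t) :
    ∃ t ∈ s, ¬ {i ∈ S | r i t}.Countable := by
  by_contra! h'
  refine hS ((hs.biUnion h').mono fun i hi => ?_)
  obtain ⟨t, ht, hr⟩ := h i hi
  exact Set.mem_biUnion ht ⟨hi, hr⟩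

theorem Set.not_countable_diff {ι : Type*} {S T : Set ι} (hS : ¬ S.Countable)
    (hT : T.Countable) : ¬ (S \ T).Countable := fun h =>
  hS ((h.union hT).mono fun i hi => by
    by_cases hi' : i ∈ T
    · exact Or.inr hi'
    · exact Or.inl ⟨hi, hi'⟩)

theorem Set.Countable.setOf_finset_subset {ι : Type*} {s : Set ι} (hs : s.Countable) :
    {K : Finset ι | (K : Set ι) ⊆ s}.Countable := by
  refine ((Set.countable_ofPred_finite_subset hs).preimage
    (Finset.coe_injective (α := ι))).mono ?_
  intro K hK
  exact ⟨K.finite_toSet, hK⟩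

theorem Set.Countable.setOf_not_disjoint {ι T : Type*} {S : Set ι} {H : ι → Finset T}
    (hH : S.PairwiseDisjoint H) {s : Set T} (hs : s.Countable) :
    {i ∈ S | ∃ x ∈ H i, x ∈ s}.Countable := by
  have : {i ∈ S | ∃ x ∈ H i, x ∈ s} ⊆ ⋃ x ∈ s, {i ∈ S | x ∈ H i} := by
    rintro i ⟨hi, x, hx, hxs⟩
    exact Set.mem_biUnion hxs ⟨hi, hx⟩
  refine (hs.biUnion fun x _ => Set.Subsingleton.countable ?_).mono this
  rintro i ⟨hi, hxi⟩ j ⟨hj, hxj⟩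
  by_contra hij
  exact Finset.disjoint_left.1 (hH hi hj hij) hxi hxj

/-- Every ordinal-indexed greedy choice that is possible over countable sets can be carried
through all countable stages. -/
theorem Omega1.exists_seq {T : Type*} (r : T → T → Prop)
    (h : ∀ s : Set T, s.Countable → ∃ x, ∀ y ∈ s, r y x) :
    ∃ f : Omega1 → T, ∀ i j, i < j → r (f i) (f j) := by
  choose g hg using fun s : {s : Set T // s.Countable} => h s.1 s.2
  have hc (j : Omega1) (F : ∀ i, i < j → T) :
      (Set.range fun i : Set.Iio j => F i.1 i.2).Countable := by
    have := (Omega1.countable_Iio_s5 j).to_subtype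
    exact Set.countable_range _
  let f : Omega1 → T := (wellFounded_lt (α := Omega1)).fix fun j F => g ⟨_, hc j F⟩
  refine ⟨f, fun i j hij => ?_⟩
  have : f j = g ⟨_, hc j fun i _ => f i⟩ := WellFounded.fix_eq _ _ _
  rw [this]
  exact hg ⟨_, hc j fun i _ => f i⟩ _ ⟨⟨i, hij⟩, rfl⟩

/-- The uncountable Δ-system lemma. -/
theorem exists_deltaSystem {ι T : Type*} [DecidableEq T] {S : Set ι} (hS : ¬ S.Countable)
    (H : ι → Finset T) :
    ∃ S' ⊆ S, ¬ S'.Countable ∧ ∃ R : Finset T, (∀ i ∈ S', R ⊆ H i) ∧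
      S'.PairwiseDisjoint fun i => H i \ R := by
  obtain ⟨n, hn⟩ := Set.exists_not_countable_fiber hS fun i => (H i).card
  suffices ∀ (n : ℕ) (S : Set ι) (H : ι → Finset T), ¬ S.Countable → (∀ i ∈ S, (H i).card = n) →
      ∃ S' ⊆ S, ¬ S'.Countable ∧ ∃ R : Finset T, (∀ i ∈ S', R ⊆ H i) ∧
        S'.PairwiseDisjoint fun i => H i \ R by
    obtain ⟨S', hS', h⟩ := this n _ H hn fun i hi => hi.2
    exact ⟨S', hS'.trans fun i hi => hi.1, h⟩
  clear hn n hS H S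
  intro n
  induction n with
  | zero =>
    intro S H hS h
    refine ⟨S, subset_rfl, hS, ∅, by simp, fun i hi j _ _ => ?_⟩
    simp [Function.onFun, Finset.card_eq_zero.1 (h i hi)]
  | succ n ih =>
    intro S H hS h
    by_cases hx : ∃ x, ¬ {i ∈ S | x ∈ H i}.Countable
    · obtain ⟨x, hx⟩ := hx
      obtain ⟨S', hS', hc, R, hR, hd⟩ := ih _ (fun i => (H i).erase x) hx (by
        rintro i ⟨hi, hxi⟩
        rw [Finset.card_erase_of_mem hxi, h i hi]; rfl)
      refine ⟨S', hS'.trans fun i hi => hi.1, hc, insert x R, fun i hi => ?_, ?_⟩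
      · exact Finset.insert_subset (hS' hi).2 ((hR i hi).trans (Finset.erase_subset _ _))
      · refine hd.mono fun i => ?_
        intro y
        simp only [Finset.mem_sdiff, Finset.mem_insert, Finset.mem_erase]
        tauto
    · push Not at hx
      obtain ⟨M, hM⟩ := zorn_subset {M : Set ι | M ⊆ S ∧ M.PairwiseDisjoint H} (by
        rintro c hc hchain
        refine ⟨⋃₀ c, ⟨Set.sUnion_subset fun s hs => (hc hs).1, ?_⟩,
          fun s hs => Set.subset_sUnion_of_mem hs⟩
        exact (Set.pairwiseDisjoint_sUnion hchain.directedOn).2 fun s hs => (hc hs).2)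
      refine ⟨M, hM.prop.1, fun hMc => ?_, ∅, by simp, by simpa using hM.prop.2⟩
      have hU : (⋃ i ∈ M, (H i : Set T)).Countable :=
        hMc.biUnion fun i _ => (H i).countable_toSet
      have hB := hMc.union (hU.biUnion fun x _ => hx x)
      obtain ⟨i, hi, hiB⟩ := Set.not_subset.1 fun hsub => hS (hB.mono hsub)
      simp only [Set.mem_union, Set.mem_iUnion, not_or, not_exists] at hiB
      refine hiB.1 (hM.le_of_ge ⟨Set.insert_subset hi hM.prop.1, ?_⟩
        (Set.subset_insert i M) (Set.mem_insert i M))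
      refine hM.prop.2.insert fun j hj _ => Finset.disjoint_left.2 fun x hxi hxj => ?_
      exact hiB.2 x ⟨j, hj, hxj⟩ ⟨hi, hxi⟩

section

open Filter Topology TopologicalSpace

/-! ### Generic pairs of a compact set and a set of ordinals -/

/-- The Cantor set. -/
abbrev Cantor : Type := ℕ → Bool

instance : Countable (Clopens Cantor) :=
  Clopens.countable_iff_secondCountable.2 inferInstance

theorem Clopens.exists_between {C : Set Cantor} (hC : IsClosed C) {U : Set Cantor}
    (hU : IsOpen U) (h : C ⊆ U) : ∃ V : Clopens Cantor, C ⊆ V ∧ (V : Set Cantor) ⊆ U := by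
  obtain ⟨V, hV, h1, h2⟩ := exists_clopen_of_closed_subset_open hC hU h
  exact ⟨⟨V, hV⟩, h1, h2⟩

/-- Every nonempty clopen subset of the Cantor set has a nonempty clopen subset not containing a
given nonempty clopen set. -/
theorem Clopens.exists_le_not_le {V B : Clopens Cantor} (hV : V ≠ ⊥) (hB : B ≠ ⊥) :
    ∃ V' ≤ V, V' ≠ ⊥ ∧ ¬ B ≤ V' := by
  by_cases hBV : B ≤ V
  · obtain ⟨x, hx⟩ : (B : Set Cantor).Nonempty := by
      rw [Set.nonempty_iff_ne_empty]
      exact fun h => hB (SetLike.coe_injective h)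
    have hacc : ∃ y ∈ B, y ≠ x := by
      have h1 : (B : Set Cantor) ∈ 𝓝 x := B.isClopen.isOpen.mem_nhds hx
      have h2 : Tendsto (fun n => Function.update x n (!x n)) atTop (𝓝 x) := by
        rw [tendsto_pi_nhds]
        intro k
        refine tendsto_const_nhds.congr' ?_
        filter_upwards [eventually_gt_atTop k] with n hn
        rw [Function.update_of_ne hn.ne]
      obtain ⟨n, hn⟩ := (h2.eventually h1).exists
      refine ⟨_, hn, fun h => ?_⟩
      have := congrFun h n
      simp at this
    obtain ⟨y, hy, hyx⟩ := hacc
    obtain ⟨W, hxW, hWs⟩ := Clopens.exists_between (isClosed_singleton (x := x))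
      (isOpen_compl_singleton (x := y)) (by simpa using hyx)
    refine ⟨B ⊓ W, inf_le_left.trans hBV, fun h => ?_, fun h => ?_⟩
    · have : x ∈ B ⊓ W := ⟨hx, hxW rfl⟩
      rw [h] at this
      exact this
    · exact hWs (h hy).2 rfl
  · exact ⟨V, le_rfl, hV, hBV⟩

theorem exists_generic {Ω ι : Type*} [DecidableEq Ω] [Countable ι]
    (L : Clopens Cantor → Finset Ω → Prop)
    (T : ι → Clopens Cantor → Finset Ω → Prop) (hne : ∀ V H, L V H → V ≠ ⊥) (h0 : L ⊤ ∅)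
    (h : ∀ i V H, L V H → ∃ V' ≤ V, ∃ H', H ⊆ H' ∧ L V' H' ∧ T i V' H') :
    ∃ (C : Set Cantor) (N : Set Ω), C.Nonempty ∧ IsClosed C ∧
      (∀ i, ∃ V H, L V H ∧ T i V H ∧ C ⊆ V ∧ ↑H ⊆ N) ∧
      (∀ (V₀ : Clopens Cantor) (H₀ : Finset Ω), C ⊆ V₀ → ↑H₀ ⊆ N →
        ∃ V H, L V H ∧ V ≤ V₀ ∧ H₀ ⊆ H) ∧
      ∀ γ ∈ N, ∃ V H, L V H ∧ γ ∈ H := by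
  let P := {p : (Clopens Cantor)ᵒᵈ × Finset Ω // L (OrderDual.ofDual p.1) p.2}
  let _ : Encodable ι := Encodable.ofCountable ι
  let 𝒟 : ι → Order.Cofinal P := fun i =>
    ⟨{p | T i (OrderDual.ofDual p.1.1) p.1.2}, by
      rintro ⟨⟨V, H⟩, hp⟩
      obtain ⟨V', hV, H', hH, hL, hT⟩ := h i _ _ hp
      exact ⟨⟨(OrderDual.toDual V', H'), hL⟩, hT, hV, hH⟩⟩
  let p₀ : P := ⟨(OrderDual.toDual ⊤, ∅), h0⟩
  let I := Order.idealOfCofinals p₀ 𝒟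
  have : Nonempty I := I.nonempty.to_subtype
  let v : I → Set Cantor := fun p => (OrderDual.ofDual p.1.1.1 : Clopens Cantor)
  have hdir : Directed (· ⊇ ·) v := by
    rintro ⟨p, hp⟩ ⟨q, hq⟩
    obtain ⟨r, hr, h1, h2⟩ := I.directed p hp q hq
    exact ⟨⟨r, hr⟩, h1.1, h2.1⟩
  have hcl (p : I) : IsClosed (v p) := Clopens.isClopen _ |>.1
  refine ⟨⋂ p, v p, ⋃ p : I, (p.1.1.2 : Set Ω), ?_, isClosed_iInter hcl, ?_, ?_, ?_⟩
  · refine IsCompact.nonempty_iInter_of_directed_nonempty_isCompact_isClosed v hdir ?_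
      (fun p => (hcl p).isCompact) hcl
    intro p
    rw [Set.nonempty_iff_ne_empty]
    exact fun h => hne _ _ p.1.2 (SetLike.coe_injective h)
  · intro i
    obtain ⟨p, hpT, hpI⟩ := Order.cofinal_meets_idealOfCofinals p₀ 𝒟 i
    exact ⟨_, _, p.2, hpT, Set.iInter_subset v ⟨p, hpI⟩,
      Set.subset_iUnion (fun p : I => (p.1.1.2 : Set Ω)) ⟨p, hpI⟩⟩
  · intro V₀ H₀ hV hH
    obtain ⟨p, hp⟩ := exists_subset_nhds_of_compactSpace hdir hcl
      fun x hx => V₀.isClopen.isOpen.mem_nhds (hV hx)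
    have hH' : ∃ q : I, H₀ ⊆ q.1.1.2 := by
      have hdir' : Directed (· ⊆ ·) fun p : I => (p.1.1.2 : Set Ω) := by
        rintro ⟨p, hp⟩ ⟨q, hq⟩
        obtain ⟨r, hr, h1, h2⟩ := I.directed p hp q hq
        exact ⟨⟨r, hr⟩, Finset.coe_subset.2 h1.2, Finset.coe_subset.2 h2.2⟩
      exact hdir'.exists_mem_subset_of_finset_subset_biUnion hH
    obtain ⟨q, hq⟩ := hH'
    obtain ⟨r, hr, h1, h2⟩ := I.directed p p.2 q q.2
    exact ⟨_, _, r.2, fun x hx => hp (h1.1 hx), hq.trans h2.2⟩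
  · intro γ hγ
    obtain ⟨p, hp⟩ := Set.mem_iUnion.1 hγ
    exact ⟨_, _, p.1.2, hp⟩

/-! ### The recursive construction -/

/-- The data chosen at a countable stage `β`: the compact set `body` of the points of rank `β`, the
set `nbr` of those `γ < β` whose basic open set contains the points of rank `β`, and whether later
stages have to respect the family guessed at `β`. -/
structure Stage where
  body : Set Cantor
  nbr : Set Omega1
  active : Prop

/-- `InBox x p V H`: the points of rank `p`, described by `x`, belong to the basic open set given by
`V` and `H`. -/
def InBox (x : Stage) (p : Omega1) (V : Clopens Cantor) (H : Finset Omega1) : Prop :=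
  x.body ⊆ V ∧ ∀ γ ∈ H, p ≤ γ ∨ γ ∈ x.nbr

/-- The sets of candidates from which stage `β` has to include an element in `nbr`. -/
def requirements (𝓕 : Omega1 → Set (Finset Omega1)) (β : Omega1) (d : ∀ γ, γ < β → Stage) :
    Set (Set (Finset Omega1)) :=
  {R | ∃ (α : Omega1) (hα : α < β) (K : Finset Omega1) (V : Clopens Cantor) (H : Finset Omega1),
    (d α hα).active ∧ (∀ p ∈ K, α < p ∧ p < β) ∧ (d α hα).body ⊆ V ∧
    (∀ γ ∈ H, γ < α ∧ γ ∈ (d α hα).nbr) ∧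
    R = {E ∈ 𝓕 α | (∀ p ∈ E, ∃ hp : p < β, InBox (d p hp) p V H) ∧
      ∀ p ∈ K, ∀ hp : p < β, ∀ γ ∈ E, γ ∈ (d p hp).nbr}}

/-- A set of ranks below `β` that looks closed and discrete from below each `α < β`. -/
def IsTame (β : Omega1) (d : ∀ γ, γ < β → Stage) (D : Set Omega1) : Prop :=
  ∀ α, ∀ hα : α < β, ∃ (V : Clopens Cantor) (H : Finset Omega1), (d α hα).body ⊆ V ∧
    (∀ γ ∈ H, γ < α ∧ γ ∈ (d α hα).nbr) ∧
    ∀ γ ∈ D, ∀ hγ : γ < α, ¬ InBox (d γ (hγ.trans hα)) γ V H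

/-- A notion of forcing for stage `β`. -/
structure IsSystem (𝓕 : Omega1 → Set (Finset Omega1)) (β : Omega1) (d : ∀ γ, γ < β → Stage)
    (D : Set Omega1) (L : Clopens Cantor → Finset Omega1 → Prop) : Prop where
  lt : ∀ V H, L V H → ∀ γ ∈ H, γ < β
  avoid : ∀ V H, L V H → ∀ γ ∈ H, γ ∉ D
  ne_bot : ∀ V H, L V H → V ≠ ⊥
  top : L ⊤ ∅
  disjoint : ∀ V H, L V H → ∀ γ, ∀ hγ : γ < β, ∃ V' ≤ V, L V' H ∧ Disjoint (V' : Set Cantor)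
    (d γ hγ).body
  thin : ∀ V H, L V H → ∀ B : Clopens Cantor, B ≠ ⊥ → ∃ V' ≤ V, L V' H ∧ ¬ B ≤ V'
  extend : ∀ V H, L V H → ∀ R ∈ requirements 𝓕 β d, ∃ E ∈ R, L V (H ∪ E)

/-- The requirements on the data `x` of stage `β`, given the data `d` of all earlier stages. -/
structure IsGoodStage (A : Omega1 → Set Omega1) (𝓕 : Omega1 → Set (Finset Omega1)) (β : Omega1)
    (d : ∀ γ, γ < β → Stage) (x : Stage) : Prop where
  nonempty : x.body.Nonempty
  closed : IsClosed x.body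
  interior_eq : interior x.body = ∅
  disjoint : ∀ γ, ∀ hγ : γ < β, Disjoint x.body (d γ hγ).body
  nbr_lt : ∀ γ ∈ x.nbr, γ < β
  avoid : IsTame β d (A β) → ∀ γ ∈ x.nbr, γ ∉ A β
  requirement : ∀ R ∈ requirements 𝓕 β d, ∃ E ∈ R, ∀ γ ∈ E, γ ∈ x.nbr
  active : (∃ L, IsSystem 𝓕 β d {γ ∈ A β | IsTame β d (A β)} L ∧
    ∀ V H, L V H → ∃ F ∈ 𝓕 β, ∀ p ∈ F, ∃ hp : p < β, InBox (d p hp) p V H) → x.active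
  accumulate : x.active → ∀ (V : Clopens Cantor) (H : Finset Omega1), x.body ⊆ V →
    (∀ γ ∈ H, γ ∈ x.nbr) → ∃ F ∈ 𝓕 β, ∀ p ∈ F, ∃ hp : p < β, InBox (d p hp) p V H

theorem InBox.mono {x : Stage} {p : Omega1} {V V' : Clopens Cantor} {H H' : Finset Omega1}
    (h : InBox x p V H) (hV : V ≤ V') (hH : H' ⊆ H) : InBox x p V' H' :=
  ⟨h.1.trans hV, fun γ hγ => h.2 γ (hH hγ)⟩

theorem countable_requirements (𝓕 : Omega1 → Set (Finset Omega1)) (β : Omega1)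
    (d : ∀ γ, γ < β → Stage) : (requirements 𝓕 β d).Countable := by
  have h1 := (Omega1.countable_Iio_s5 β).to_subtype
  have h2 := ((Omega1.countable_Iio_s5 β).setOf_finset_subset).to_subtype
  refine (Set.countable_range fun q : Set.Iio β × {K : Finset Omega1 | (K : Set Omega1) ⊆ Set.Iio β}
    × Clopens Cantor × {K : Finset Omega1 | (K : Set Omega1) ⊆ Set.Iio β} =>
    {E ∈ 𝓕 q.1 | (∀ p ∈ E, ∃ hp : p < β, InBox (d p hp) p q.2.2.1 q.2.2.2.1) ∧
      ∀ p ∈ q.2.1.1, ∀ hp : p < β, ∀ γ ∈ E, γ ∈ (d p hp).nbr}).mono ?_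
  rintro R ⟨α, hα, K, V, H, -, hK, -, hH, rfl⟩
  exact ⟨(⟨α, hα⟩, ⟨K, fun p hp => (hK p hp).2⟩, V, ⟨H, fun γ hγ => (hH γ hγ).1.trans hα⟩), rfl⟩

theorem IsSystem.exists_body {𝓕 : Omega1 → Set (Finset Omega1)} {β : Omega1}
    {d : ∀ γ, γ < β → Stage} {D : Set Omega1} {L : Clopens Cantor → Finset Omega1 → Prop}
    (hL : IsSystem 𝓕 β d D L) :
    ∃ (C : Set Cantor) (N : Set Omega1), C.Nonempty ∧ IsClosed C ∧ interior C = ∅ ∧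
      (∀ γ, ∀ hγ : γ < β, Disjoint C (d γ hγ).body) ∧ (∀ γ ∈ N, γ < β) ∧ (∀ γ ∈ N, γ ∉ D) ∧
      (∀ R ∈ requirements 𝓕 β d, ∃ E ∈ R, ∀ γ ∈ E, γ ∈ N) ∧
      ∀ (V₀ : Clopens Cantor) (H₀ : Finset Omega1), C ⊆ V₀ → ↑H₀ ⊆ N →
        ∃ V H, L V H ∧ V ≤ V₀ ∧ H₀ ⊆ H := by
  have h1 := (Omega1.countable_Iio_s5 β).to_subtype
  have h2 := (countable_requirements 𝓕 β d).to_subtype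
  let T : (Set.Iio β ⊕ {B : Clopens Cantor // B ≠ ⊥} ⊕ requirements 𝓕 β d) →
      Clopens Cantor → Finset Omega1 → Prop := fun i V H =>
    match i with
    | .inl γ => Disjoint (V : Set Cantor) (d γ.1 γ.2).body
    | .inr (.inl B) => ¬ B.1 ≤ V
    | .inr (.inr R) => ∃ E ∈ R.1, E ⊆ H
  obtain ⟨C, N, hne, hcl, hT, hacc, hN⟩ := exists_generic L T hL.ne_bot hL.top (by
    rintro (⟨γ, hγ⟩ | ⟨B, hB⟩ | ⟨R, hR⟩) V H hVH
    · obtain ⟨V', hV', h⟩ := hL.disjoint V H hVH γ hγ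
      exact ⟨V', hV', H, subset_rfl, h⟩
    · obtain ⟨V', hV', h⟩ := hL.thin V H hVH B hB
      exact ⟨V', hV', H, subset_rfl, h⟩
    · obtain ⟨E, hE, h⟩ := hL.extend V H hVH R hR
      exact ⟨V, le_rfl, _, Finset.subset_union_left, h, E, hE, Finset.subset_union_right⟩)
  refine ⟨C, N, hne, hcl, ?_, ?_, ?_, ?_, ?_, hacc⟩
  · by_contra hint
    obtain ⟨x, hx⟩ := Set.nonempty_iff_ne_empty.2 hint
    obtain ⟨B, hxB, hB⟩ := Clopens.exists_between (isClosed_singleton (x := x))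
      (isOpen_interior (s := C)) (by simpa using hx)
    obtain ⟨V, H, -, hnot, hCV, -⟩ := hT (.inr (.inl ⟨B, fun h => by
      have : x ∈ B := hxB rfl
      rw [h] at this
      exact this⟩))
    exact hnot fun y hy => hCV (interior_subset (hB hy))
  · intro γ hγ
    obtain ⟨V, H, -, hd, hCV, -⟩ := hT (.inl ⟨γ, hγ⟩)
    exact Set.disjoint_of_subset_left hCV hd
  · intro γ hγ
    obtain ⟨V, H, h, hH⟩ := hN γ hγ
    exact hL.lt V H h γ hH
  · intro γ hγ
    obtain ⟨V, H, h, hH⟩ := hN γ hγ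
    exact hL.avoid V H h γ hH
  · intro R hR
    obtain ⟨V, H, -, ⟨E, hE, hEH⟩, -, hHN⟩ := hT (.inr (.inr ⟨R, hR⟩))
    exact ⟨E, hE, fun γ hγ => hHN (hEH hγ)⟩

theorem exists_isGoodStage (A : Omega1 → Set Omega1) (𝓕 : Omega1 → Set (Finset Omega1))
    (β : Omega1) (d : ∀ γ, γ < β → Stage) (hcl : ∀ γ, ∀ hγ : γ < β, IsClosed (d γ hγ).body)
    (hint : ∀ γ, ∀ hγ : γ < β, interior (d γ hγ).body = ∅)
    (hreq : ∀ R ∈ requirements 𝓕 β d, ∃ E ∈ R, ∀ γ ∈ E, γ < β ∧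
      γ ∉ {γ ∈ A β | IsTame β d (A β)}) :
    ∃ x, IsGoodStage A 𝓕 β d x := by
  by_cases hact : ∃ L, IsSystem 𝓕 β d {γ ∈ A β | IsTame β d (A β)} L ∧
    ∀ V H, L V H → ∃ F ∈ 𝓕 β, ∀ p ∈ F, ∃ hp : p < β, InBox (d p hp) p V H
  · obtain ⟨L, hL, hF⟩ := id hact
    obtain ⟨C, N, h1, h2, h3, h4, h5, h6, h7, h8⟩ := hL.exists_body
    refine ⟨⟨C, N, True⟩, h1, h2, h3, h4, h5, fun ht γ hγ hA => h6 γ hγ ⟨hA, ht⟩, h7,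
      fun _ => trivial, fun _ V H hV hH => ?_⟩
    obtain ⟨V', H', hL', hV', hH'⟩ := h8 V H hV hH
    obtain ⟨F, hF, hbox⟩ := hF V' H' hL'
    refine ⟨F, hF, fun p hp => ?_⟩
    obtain ⟨hpβ, hb⟩ := hbox p hp
    exact ⟨hpβ, hb.mono hV' hH'⟩
  · have hL : IsSystem 𝓕 β d {γ ∈ A β | IsTame β d (A β)} fun V H => V ≠ ⊥ ∧ ∀ γ ∈ H, γ < β ∧
        γ ∉ {γ ∈ A β | IsTame β d (A β)} := by
      refine ⟨fun V H h γ hγ => (h.2 γ hγ).1, fun V H h γ hγ => (h.2 γ hγ).2, fun V H h => h.1,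
        ⟨fun h => ?_, by simp⟩, ?_, ?_, ?_⟩
      · have : (fun _ => true : Cantor) ∈ (⊤ : Clopens Cantor) := trivial
        rw [h] at this
        exact this
      · rintro V H ⟨hV, hH⟩ γ hγ
        have hne : ¬ (V : Set Cantor) ⊆ (d γ hγ).body := fun hsub => by
          have := interior_maximal hsub V.isClopen.isOpen
          rw [hint γ hγ, Set.subset_empty_iff] at this
          exact hV (SetLike.coe_injective this)
        obtain ⟨x, hxV, hx⟩ := Set.not_subset.1 hne
        obtain ⟨W, hxW, hW⟩ := Clopens.exists_between (isClosed_singleton (x := x))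
          (V.isClopen.isOpen.sdiff (hcl γ hγ)) (by simpa using ⟨hxV, hx⟩)
        refine ⟨W, fun y hy => (hW hy).1, ⟨fun h => ?_, hH⟩,
          Set.disjoint_left.2 fun y hy => (hW hy).2⟩
        have : x ∈ W := hxW rfl
        rw [h] at this
        exact this
      · rintro V H ⟨hV, hH⟩ B hB
        obtain ⟨V', hV', hne, h⟩ := Clopens.exists_le_not_le hV hB
        exact ⟨V', hV', ⟨hne, hH⟩, h⟩
      · rintro V H ⟨hV, hH⟩ R hR
        obtain ⟨E, hE, h⟩ := hreq R hR
        refine ⟨E, hE, hV, fun γ hγ => ?_⟩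
        rcases Finset.mem_union.1 hγ with hγ | hγ
        exacts [hH γ hγ, h γ hγ]
    obtain ⟨C, N, h1, h2, h3, h4, h5, h6, h7, -⟩ := hL.exists_body
    exact ⟨⟨C, N, False⟩, h1, h2, h3, h4, h5, fun ht γ hγ hA => h6 γ hγ ⟨hA, ht⟩, h7,
      fun h => hact h, fun h => h.elim⟩

theorem IsGoodStage.exists_common {A : Omega1 → Set Omega1} {𝓕 : Omega1 → Set (Finset Omega1)}
    {G : Omega1 → Stage} {α : Omega1} (hα : IsGoodStage A 𝓕 α (fun γ _ => G γ) (G α))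
    (hact : (G α).active) (K : Finset Omega1)
    (hK : ∀ p ∈ K, α < p ∧ IsGoodStage A 𝓕 p (fun γ _ => G γ) (G p))
    (V : Clopens Cantor) (H : Finset Omega1) (hV : (G α).body ⊆ V)
    (hH : ∀ γ ∈ H, γ ∈ (G α).nbr) :
    ∃ E ∈ 𝓕 α, (∀ p ∈ E, InBox (G p) p V H) ∧ ∀ p ∈ K, ∀ γ ∈ E, γ ∈ (G p).nbr := by
  rcases K.eq_empty_or_nonempty with rfl | hne
  · obtain ⟨E, hE, h⟩ := hα.accumulate hact V H hV hH
    exact ⟨E, hE, fun p hp => (h p hp).2, by simp⟩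
  · have hmax := K.max'_mem hne
    obtain ⟨E, ⟨hE, hbox, hcom⟩, hEN⟩ := (hK _ hmax).2.requirement _ ⟨α, (hK _ hmax).1,
      K.erase (K.max' hne), V, H, hact, fun p hp => ⟨(hK p (Finset.mem_of_mem_erase hp)).1,
        lt_of_le_of_ne (K.le_max' p (Finset.mem_of_mem_erase hp)) (Finset.ne_of_mem_erase hp)⟩,
      hV, fun γ hγ => ⟨hα.nbr_lt γ (hH γ hγ), hH γ hγ⟩, rfl⟩
    refine ⟨E, hE, fun p hp => (hbox p hp).2, fun p hp => ?_⟩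
    by_cases hpm : p = K.max' hne
    · rw [hpm]
      exact hEN
    · exact hcom p (Finset.mem_erase.2 ⟨hpm, hp⟩) (lt_of_le_of_ne (K.le_max' p hp) hpm)

theorem exists_forall_isGoodStage (A : Omega1 → Set Omega1) (𝓕 : Omega1 → Set (Finset Omega1))
    (h𝓕 : ∀ α, ∀ F ∈ 𝓕 α, ∀ p ∈ F, p < α) :
    ∃ G : Omega1 → Stage, ∀ β, IsGoodStage A 𝓕 β (fun γ _ => G γ) (G β) := by
  classical
  let next : ∀ β : Omega1, (∀ γ, γ < β → Stage) → Stage := fun β d =>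
    if h : ∃ x, IsGoodStage A 𝓕 β d x then h.choose else ⟨∅, ∅, False⟩
  let G : Omega1 → Stage := (wellFounded_lt (α := Omega1)).fix next
  have hG (β : Omega1) : G β = next β fun γ _ => G γ := WellFounded.fix_eq _ _ _
  refine ⟨G, fun β => ?_⟩
  induction β using WellFoundedLT.induction with
  | ind β ih =>
  suffices h : ∃ x, IsGoodStage A 𝓕 β (fun γ _ => G γ) x by
    rw [hG β]
    simp only [next, dif_pos h]
    exact h.choose_spec
  refine exists_isGoodStage A 𝓕 β _ (fun γ hγ => (ih γ hγ).closed)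
    (fun γ hγ => (ih γ hγ).interior_eq) ?_
  rintro R ⟨α, hα, K, V, H, hact, hK, hV, hH, rfl⟩
  by_cases ht : IsTame β (fun γ _ => G γ) (A β)
  · obtain ⟨V', H', hV', hH', hno⟩ := ht α hα
    obtain ⟨E, hE, hbox, hcom⟩ := (ih α hα).exists_common hact K
      (fun p hp => ⟨(hK p hp).1, ih p (hK p hp).2⟩) (V ⊓ V') (H ∪ H')
      (Set.subset_inter hV hV') (fun γ hγ => by
        rcases Finset.mem_union.1 hγ with h | h
        exacts [(hH γ h).2, (hH' γ h).2])
    refine ⟨E, ⟨hE, fun p hp => ⟨(h𝓕 α E hE p hp).trans hα,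
      (hbox p hp).mono inf_le_left Finset.subset_union_left⟩, fun p hp _ => hcom p hp⟩,
      fun γ hγ => ⟨(h𝓕 α E hE γ hγ).trans hα, fun hA => ?_⟩⟩
    exact hno γ hA.1 (h𝓕 α E hE γ hγ) ((hbox γ hγ).mono inf_le_right Finset.subset_union_right)
  · obtain ⟨E, hE, hbox, hcom⟩ := (ih α hα).exists_common hact K
      (fun p hp => ⟨(hK p hp).1, ih p (hK p hp).2⟩) V H hV (fun γ hγ => (hH γ hγ).2)
    exact ⟨E, ⟨hE, fun p hp => ⟨(h𝓕 α E hE p hp).trans hα, hbox p hp⟩, fun p hp _ => hcom p hp⟩,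
      fun γ hγ => ⟨(h𝓕 α E hE γ hγ).trans hα, fun hA => ht hA.2⟩⟩

/-! ### Uncountable disjoint families are captured -/

theorem Omega1.isClubIn_setOf_closed (f : Finset Omega1 → Omega1) :
    IsClubIn {α | ∀ H : Finset Omega1, (∀ γ ∈ H, γ < α) → f H < α} := by
  refine ⟨fun a => ?_, fun a ha hlim H hH => ?_⟩
  · have hstep (a : Omega1) : ∃ b, a < b ∧ ∀ H : Finset Omega1, (∀ γ ∈ H, γ < a) → f H < b := by
      obtain ⟨b, hb⟩ := Omega1.exists_gt_of_countable_s5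
        (((Omega1.countable_Iio_s5 a).setOf_finset_subset.image f).insert a)
      exact ⟨b, hb _ (Set.mem_insert _ _), fun H hH =>
        hb _ (Set.mem_insert_of_mem _ ⟨H, fun γ hγ => hH γ hγ, rfl⟩)⟩
    choose g hg hgf using hstep
    have hmono (n : ℕ) : g^[n] a < g^[n + 1] a := by
      rw [Function.iterate_succ_apply']
      exact hg _
    have hsm : StrictMono fun n => g^[n] a := strictMono_nat_of_lt_succ hmono
    obtain ⟨u, hu⟩ := Omega1.exists_gt_of_countable_s5 (Set.countable_range fun n => g^[n] a)
    obtain ⟨α, hα, hmin⟩ := (wellFounded_lt (α := Omega1)).has_min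
      {x | ∀ n, g^[n] a < x} ⟨u, fun n => hu _ ⟨n, rfl⟩⟩
    refine ⟨α, fun H hH => ?_, hα 0⟩
    have hb : ∃ n, ∀ γ ∈ H, γ < g^[n] a := by
      have h1 (γ : Omega1) (hγ : γ < α) : ∃ n, γ < g^[n] a := by
        obtain ⟨n, hn⟩ : ∃ n, γ ≤ g^[n] a := by
          by_contra! h
          exact hmin γ h hγ
        exact ⟨n + 1, hn.trans_lt (hmono n)⟩
      choose! n hn using h1
      exact ⟨H.sup n, fun γ hγ =>
        (hn γ (hH γ hγ)).trans_le (hsm.monotone (Finset.le_sup hγ))⟩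
    obtain ⟨n, hn⟩ := hb
    have := hgf _ H hn
    rw [← Function.iterate_succ_apply' g] at this
    exact this.trans (hα _)
  · have hb : ∃ b < a, ∀ γ ∈ H, γ ≤ b := by
      rcases H.eq_empty_or_nonempty with rfl | hne
      · obtain ⟨b, hb⟩ := ha
        exact ⟨b, hb, by simp⟩
      · exact ⟨H.max' hne, hH _ (H.max'_mem hne), fun γ hγ => H.le_max' γ hγ⟩
    obtain ⟨b, hb, hHb⟩ := hb
    obtain ⟨c, hc, hbc, hca⟩ := hlim b hb
    exact (hc H fun γ hγ => (hHb γ hγ).trans_lt hbc).trans hca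

/-- The members of `𝒢` all of whose points belong to the basic open set given by `V` and `H`. -/
def captured (G : Omega1 → Stage) (𝒢 : Set (Finset Omega1)) (V : Clopens Cantor)
    (H : Finset Omega1) : Set (Finset Omega1) :=
  {F ∈ 𝒢 | ∀ p ∈ F, InBox (G p) p V H}

theorem exists_not_countable_captured {G : Omega1 → Stage} {𝒢 T : Set (Finset Omega1)}
    (hT : T.Countable) {V : Clopens Cantor} {H : Finset Omega1}
    (h : ¬ (captured G 𝒢 V H).Countable) (P : Clopens Cantor → Prop)
    (hP : ∀ F ∈ captured G 𝒢 V H, F ∉ T → ∃ V' ≤ V, P V' ∧ ∀ p ∈ F, (G p).body ⊆ V') :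
    ∃ V' ≤ V, P V' ∧ ¬ (captured G 𝒢 V' H).Countable := by
  obtain ⟨V', hV', hc⟩ := Set.exists_not_countable_of_forall_exists
    (Set.to_countable {V' | V' ≤ V ∧ P V'}) (Set.not_countable_diff h hT)
    (fun F V' => ∀ p ∈ F, (G p).body ⊆ V') (by
      rintro F ⟨hF, hFT⟩
      obtain ⟨V', h1, h2, h3⟩ := hP F hF hFT
      exact ⟨V', ⟨h1, h2⟩, h3⟩)
  refine ⟨V', hV'.1, hV'.2, fun h => hc (h.mono ?_)⟩
  rintro F ⟨⟨hF, -⟩, hFV⟩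
  exact ⟨hF.1, fun p hp => ⟨hFV p hp, (hF.2 p hp).2⟩⟩

section

variable {A : Omega1 → Set Omega1} {𝓕 : Omega1 → Set (Finset Omega1)} {G : Omega1 → Stage}

theorem disjoint_body (hG : ∀ β, IsGoodStage A 𝓕 β (fun γ _ => G γ) (G β))
    {p q : Omega1} (h : p ≠ q) : Disjoint (G p).body (G q).body := by
  rcases lt_or_gt_of_ne h with h | h
  · exact ((hG q).disjoint p h).symm
  · exact (hG p).disjoint q h

theorem isClosed_biUnion_body (hG : ∀ β, IsGoodStage A 𝓕 β (fun γ _ => G γ) (G β))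
    (F : Finset Omega1) : IsClosed (⋃ p ∈ F, (G p).body) :=
  F.finite_toSet.isClosed_biUnion fun p _ => (hG p).closed

theorem interior_biUnion_body (hG : ∀ β, IsGoodStage A 𝓕 β (fun γ _ => G γ) (G β))
    (F : Finset Omega1) : interior (⋃ p ∈ F, (G p).body) = ∅ := by
  classical
  induction F using Finset.induction_on with
  | empty => simp
  | insert p F hp ih =>
    rw [Finset.set_biUnion_insert, Set.union_comm,
      interior_union_isClosed_of_interior_empty (isClosed_biUnion_body hG F) (hG p).interior_eq]
    exact ih

theorem isSystem_captured (hG : ∀ β, IsGoodStage A 𝓕 β (fun γ _ => G γ) (G β))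
    (h𝓕 : ∀ α, ∀ F ∈ 𝓕 α, ∀ p ∈ F, p < α) (α : Omega1)
    {𝒢 : Set (Finset Omega1)} (h𝒢 : ¬ 𝒢.Countable) (hdis : 𝒢.PairwiseDisjoint id)
    (hne : ∀ F ∈ 𝒢, F.Nonempty) :
    IsSystem 𝓕 α (fun γ _ => G γ) {γ ∈ A α | IsTame α (fun γ _ => G γ) (A α)} fun V H =>
      (∀ γ ∈ H, γ < α ∧ γ ∉ {γ ∈ A α | IsTame α (fun γ _ => G γ) (A α)}) ∧
        ¬ (captured G 𝒢 V H).Countable := by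
  refine ⟨fun V H h γ hγ => (h.1 γ hγ).1, fun V H h γ hγ => (h.1 γ hγ).2, ?_,
    ⟨by simp, fun h => h𝒢 (h.mono ?_)⟩, ?_, ?_, ?_⟩
  · rintro V H ⟨-, h⟩ rfl
    refine h (Set.Countable.mono ?_ Set.countable_empty)
    rintro F ⟨hF, hbox⟩
    obtain ⟨p, hp⟩ := hne F hF
    obtain ⟨x, hx⟩ := (hG p).nonempty
    exact (hbox p hp).1 hx
  · exact fun F hF => ⟨hF, fun p _ => ⟨fun _ _ => trivial, by simp⟩⟩
  · rintro V H ⟨hH, h⟩ γ hγ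
    obtain ⟨V', hV', hd, hc⟩ := exists_not_countable_captured
      (Set.Countable.setOf_not_disjoint hdis (Set.countable_singleton γ)) h
      (fun V' => Disjoint (V' : Set Cantor) (G γ).body) (by
        intro F hF hγF
        obtain ⟨V', h1, h2⟩ := Clopens.exists_between (isClosed_biUnion_body hG F)
          (V.isClopen.isOpen.sdiff (hG γ).closed) (by
            refine Set.iUnion₂_subset fun p hp x hx => ⟨(hF.2 p hp).1 hx, fun hxγ => ?_⟩
            refine Set.disjoint_left.1 (disjoint_body hG ?_) hx hxγ
            rintro rfl
            exact hγF ⟨hF.1, p, hp, rfl⟩)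
        exact ⟨V', fun x hx => (h2 hx).1, Set.disjoint_left.2 fun x hx => (h2 hx).2,
          fun p hp => (Set.subset_biUnion_of_mem (u := fun p => (G p).body) hp).trans h1⟩)
    exact ⟨V', hV', ⟨hH, hc⟩, hd⟩
  · rintro V H ⟨hH, h⟩ B hB
    obtain ⟨V', hV', hd, hc⟩ := exists_not_countable_captured Set.countable_empty h
      (fun V' => ¬ B ≤ V') (by
        intro F hF _
        have hnot : ¬ (B : Set Cantor) ⊆ ⋃ p ∈ F, (G p).body := fun hsub => by
          have := interior_maximal hsub B.isClopen.isOpen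
          rw [interior_biUnion_body hG, Set.subset_empty_iff] at this
          exact hB (SetLike.coe_injective this)
        obtain ⟨b, hbB, hb⟩ := Set.not_subset.1 hnot
        obtain ⟨V', h1, h2⟩ := Clopens.exists_between (isClosed_biUnion_body hG F)
          (V.isClopen.isOpen.sdiff (isClosed_singleton (x := b))) (by
            refine Set.subset_sdiff_singleton (Set.iUnion₂_subset fun p hp => (hF.2 p hp).1) hb)
        exact ⟨V', fun x hx => (h2 hx).1, fun hle => (h2 (hle hbB)).2 rfl,
          fun p hp => (Set.subset_biUnion_of_mem (u := fun p => (G p).body) hp).trans h1⟩)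
    exact ⟨V', hV', ⟨hH, hc⟩, hd⟩
  · rintro V H ⟨hH, h⟩ R ⟨α', hα', K, V₀, H₀, hact, hK, hV₀, hH₀, rfl⟩
    have key (F : Finset Omega1) (hF : ∀ p ∈ F, α' < p) : ∃ E ∈ {E ∈ 𝓕 α' |
        (∀ p ∈ E, ∃ _ : p < α, InBox (G p) p V₀ H₀) ∧ ∀ p ∈ K, p < α → ∀ γ ∈ E, γ ∈ (G p).nbr},
        (∀ γ ∈ E, γ < α ∧ γ ∉ {γ ∈ A α | IsTame α (fun γ _ => G γ) (A α)}) ∧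
        ∀ p ∈ F, ∀ γ ∈ E, γ ∈ (G p).nbr := by
      have hKF : ∀ p ∈ K ∪ F, α' < p ∧ IsGoodStage A 𝓕 p (fun γ _ => G γ) (G p) := by
        intro p hp
        rcases Finset.mem_union.1 hp with hp | hp
        exacts [⟨(hK p hp).1, hG p⟩, ⟨hF p hp, hG p⟩]
      by_cases ht : IsTame α (fun γ _ => G γ) (A α)
      · obtain ⟨V', H', hV', hH', hno⟩ := ht α' hα'
        obtain ⟨E, hE, hbox, hcom⟩ := (hG α').exists_common hact (K ∪ F) hKF (V₀ ⊓ V') (H₀ ∪ H')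
          (Set.subset_inter hV₀ hV') (fun γ hγ => by
            rcases Finset.mem_union.1 hγ with h | h
            exacts [(hH₀ γ h).2, (hH' γ h).2])
        refine ⟨E, ⟨hE, fun p hp => ⟨(h𝓕 α' E hE p hp).trans hα',
          (hbox p hp).mono inf_le_left Finset.subset_union_left⟩,
          fun p hp _ => hcom p (Finset.mem_union_left _ hp)⟩,
          fun γ hγ => ⟨(h𝓕 α' E hE γ hγ).trans hα', fun hA => ?_⟩,
          fun p hp => hcom p (Finset.mem_union_right _ hp)⟩
        exact hno γ hA.1 (h𝓕 α' E hE γ hγ) ((hbox γ hγ).mono inf_le_right Finset.subset_union_right)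
      · obtain ⟨E, hE, hbox, hcom⟩ := (hG α').exists_common hact (K ∪ F) hKF V₀ H₀ hV₀
          (fun γ hγ => (hH₀ γ hγ).2)
        exact ⟨E, ⟨hE, fun p hp => ⟨(h𝓕 α' E hE p hp).trans hα', hbox p hp⟩,
          fun p hp _ => hcom p (Finset.mem_union_left _ hp)⟩,
          fun γ hγ => ⟨(h𝓕 α' E hE γ hγ).trans hα', fun hA => ht hA.2⟩,
          fun p hp => hcom p (Finset.mem_union_right _ hp)⟩
    obtain ⟨E, ⟨hER, -, hEα⟩, hc⟩ := Set.exists_not_countable_of_forall_exists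
      (s := {E | E ∈ {E ∈ 𝓕 α' | (∀ p ∈ E, ∃ _ : p < α, InBox (G p) p V₀ H₀) ∧
        ∀ p ∈ K, p < α → ∀ γ ∈ E, γ ∈ (G p).nbr} ∧ (E : Set Omega1) ⊆ Set.Iio α ∧
        ∀ γ ∈ E, γ < α ∧ γ ∉ {γ ∈ A α | IsTame α (fun γ _ => G γ) (A α)}})
      ((Omega1.countable_Iio_s5 α).setOf_finset_subset.mono fun E hE => hE.2.1)
      (Set.not_countable_diff h
        (Set.Countable.setOf_not_disjoint hdis (Omega1.countable_Iic α')))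
      (fun F E => ∀ p ∈ F, ∀ γ ∈ E, γ ∈ (G p).nbr) (by
        rintro F ⟨hF, hFα⟩
        obtain ⟨E, h1, h2, h3⟩ := key F fun p hp => not_le.1 fun hle => hFα ⟨hF.1, p, hp, hle⟩
        exact ⟨E, ⟨h1, fun γ hγ => (h2 γ hγ).1, h2⟩, h3⟩)
    refine ⟨E, hER, ⟨fun γ hγ => ?_, fun hcount => hc (hcount.mono ?_)⟩⟩
    · rcases Finset.mem_union.1 hγ with hγ | hγ
      exacts [hH γ hγ, hEα γ hγ]
    · rintro F ⟨⟨hF, -⟩, hFE⟩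
      refine ⟨hF.1, fun p hp => ⟨(hF.2 p hp).1, fun γ hγ => ?_⟩⟩
      rcases Finset.mem_union.1 hγ with hγ | hγ
      exacts [(hF.2 p hp).2 γ hγ, Or.inr (hFE p hp γ hγ)]

/-- Every uncountable disjoint family of finite sets is caught at some countable stage. -/
theorem exists_forall_exists_subset_nbr (hG : ∀ β, IsGoodStage A 𝓕 β (fun γ _ => G γ) (G β))
    (e : Omega1 ≃ Finset Omega1)
    (hA : ∀ B : Set Omega1, IsStationaryIn {α | B ∩ {β | β < α} = A α})
    (h𝓕 : ∀ α F, F ∈ 𝓕 α ↔ e.symm F ∈ A α ∧ ∀ p ∈ F, p < α)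
    {𝒢 : Set (Finset Omega1)} (h𝒢 : ¬ 𝒢.Countable) (hdis : 𝒢.PairwiseDisjoint id)
    (hne : ∀ F ∈ 𝒢, F.Nonempty) :
    ∃ α, ∀ K : Finset Omega1, (∀ p ∈ K, α < p) →
      ∃ F ∈ 𝒢, (∀ p ∈ F, p < α) ∧ ∀ p ∈ K, ∀ γ ∈ F, γ ∈ (G p).nbr := by
  have hf (H : Finset Omega1) : ∃ b : Omega1, ∀ V : Clopens Cantor, (captured G 𝒢 V H).Nonempty →
      ∃ F ∈ captured G 𝒢 V H, (∀ p ∈ F, p < b) ∧ e.symm F < b := by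
    have h1 (V : Clopens Cantor) : ∃ b : Omega1, (captured G 𝒢 V H).Nonempty →
      ∃ F ∈ captured G 𝒢 V H, (∀ p ∈ F, p < b) ∧ e.symm F < b := by
      by_cases hn : (captured G 𝒢 V H).Nonempty
      · obtain ⟨F, hF⟩ := hn
        obtain ⟨b, hb⟩ := Omega1.exists_gt_of_countable_s5
          (F.finite_toSet.insert (e.symm F)).countable
        exact ⟨b, fun _ => ⟨F, hF, fun p hp => hb p (Set.mem_insert_of_mem _ hp),
          hb _ (Set.mem_insert _ _)⟩⟩
      · exact ⟨Classical.arbitrary _, fun h => (hn h).elim⟩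
    choose b hb using h1
    obtain ⟨c, hc⟩ := Omega1.exists_gt_of_countable_s5 (Set.countable_range b)
    refine ⟨c, fun V hV => ?_⟩
    obtain ⟨F, hF, h1, h2⟩ := hb V hV
    have := hc (b V) ⟨V, rfl⟩
    exact ⟨F, hF, fun p hp => (h1 p hp).trans this, h2.trans this⟩
  choose f hf using hf
  obtain ⟨α, hαA, hα⟩ := hA {ξ | e ξ ∈ 𝒢} _ (Omega1.isClubIn_setOf_closed f)
  have hmem (F : Finset Omega1) : F ∈ 𝓕 α ↔ F ∈ 𝒢 ∧ e.symm F < α ∧ ∀ p ∈ F, p < α := by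
    rw [h𝓕, ← show _ = A α from hαA]
    simp [and_assoc]
  have hlt : ∀ α, ∀ F ∈ 𝓕 α, ∀ p ∈ F, p < α := fun α F hF => ((h𝓕 α F).1 hF).2
  have hact : (G α).active := by
    refine (hG α).active ⟨_, isSystem_captured hG hlt α h𝒢 hdis hne, ?_⟩
    rintro V H ⟨hH, hc⟩
    have hn : (captured G 𝒢 V H).Nonempty := by
      by_contra hn
      rw [Set.not_nonempty_iff_eq_empty] at hn
      exact hc (hn ▸ Set.countable_empty)
    obtain ⟨F, hF, h1, h2⟩ := hf H V hn
    have hfα := hα H fun γ hγ => (hH γ hγ).1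
    exact ⟨F, (hmem F).2 ⟨hF.1, h2.trans hfα, fun p hp => (h1 p hp).trans hfα⟩,
      fun p hp => ⟨(h1 p hp).trans hfα, hF.2 p hp⟩⟩
  refine ⟨α, fun K hK => ?_⟩
  obtain ⟨F, hF, -, hcom⟩ := (hG α).exists_common hact K (fun p hp => ⟨hK p hp, hG p⟩) ⊤ ∅
    (fun _ _ => trivial) (by simp)
  exact ⟨F, ((hmem F).1 hF).1, ((hmem F).1 hF).2.2, hcom⟩

end


/-! ### The space -/

theorem IsEpsilonSpace.lindelofSpace {X : Type*} [TopologicalSpace X] (h : IsEpsilonSpace X) :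
    LindelofSpace X := by
  refine ⟨isLindelof_of_countable_subcover fun {ι} U hU hcov => ?_⟩
  obtain ⟨𝒱, h𝒱, hc, hω⟩ := h (Set.range fun t : Finset ι => ⋃ i ∈ t, U i) (by
      rintro _ ⟨t, rfl⟩
      exact isOpen_biUnion fun i _ => hU i) (by
      intro K
      classical
      choose g hg using fun x => Set.mem_iUnion.1 (hcov (Set.mem_univ x))
      exact ⟨_, ⟨K.image g, rfl⟩, fun x hx =>
        Set.mem_biUnion (Finset.mem_coe.2 (Finset.mem_image_of_mem g hx)) (hg x)⟩)
  choose! t ht using fun W (hW : W ∈ 𝒱) => h𝒱 hW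
  refine ⟨⋃ W ∈ 𝒱, (t W : Set ι), hc.biUnion fun W _ => (t W).countable_toSet, fun x _ => ?_⟩
  obtain ⟨W, hW, hxW⟩ := hω {x}
  have hx : x ∈ W := hxW (by simp)
  rw [← ht W hW] at hx
  obtain ⟨i, hi, hxi⟩ := Set.mem_iUnion₂.1 hx
  exact Set.mem_biUnion (Set.mem_biUnion hW hi) hxi

/-- Every uncountable disjoint family of finite sets is caught at some countable stage. -/
def CapturesFamilies (G : Omega1 → Stage) : Prop :=
  ∀ 𝒢 : Set (Finset Omega1), ¬ 𝒢.Countable → 𝒢.PairwiseDisjoint id → (∀ F ∈ 𝒢, F.Nonempty) →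
    ∃ α, ∀ K : Finset Omega1, (∀ p ∈ K, α < p) →
      ∃ F ∈ 𝒢, (∀ p ∈ F, p < α) ∧ ∀ p ∈ K, ∀ γ ∈ F, γ ∈ (G p).nbr

theorem CapturesFamilies.exists_countable {G : Omega1 → Stage} (hG : CapturesFamilies G)
    {ι : Type*} {S : Set ι} (hS : ¬ S.Countable) {H : ι → Finset Omega1}
    (hdis : S.PairwiseDisjoint H) :
    ∃ α, ∃ S₀ ⊆ S, S₀.Countable ∧ ∀ K : Finset Omega1, (∀ p ∈ K, α < p) →
      ∃ i ∈ S₀, ∀ p ∈ K, ∀ γ ∈ H i, γ ∈ (G p).nbr := by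
  by_cases hne : ∃ i ∈ S, H i = ∅
  · obtain ⟨i, hi, h⟩ := hne
    exact ⟨Classical.arbitrary _, {i}, Set.singleton_subset_iff.2 hi, Set.countable_singleton i,
      fun K _ => ⟨i, rfl, by simp [h]⟩⟩
  · push Not at hne
    have hinj : S.InjOn H := fun i hi j hj hij => by
      by_contra hne'
      have := hdis hi hj hne'
      rw [Function.onFun, ← hij, disjoint_self] at this
      exact (hne i hi).ne_empty this
    obtain ⟨α, hα⟩ := hG (H '' S) (fun h => hS (Set.countable_of_injective_of_countable_image hinj h))
      (by
        rintro _ ⟨i, hi, rfl⟩ _ ⟨j, hj, rfl⟩ hij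
        exact hdis hi hj fun h => hij (h ▸ rfl))
      (by
        rintro _ ⟨i, hi, rfl⟩
        exact hne i hi)
    refine ⟨α, {i ∈ S | (H i : Set Omega1) ⊆ Set.Iio α}, fun i hi => hi.1, ?_, fun K hK => ?_⟩
    · refine Set.MapsTo.countable_of_injOn (f := H) (fun i hi => hi.2)
        (hinj.mono fun i hi => hi.1) (Omega1.countable_Iio_s5 α).setOf_finset_subset
    · obtain ⟨_, ⟨i, hi, rfl⟩, h1, h2⟩ := hα K hK
      exact ⟨i, ⟨hi, fun γ hγ => h1 γ hγ⟩, h2⟩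

/-- The points of the bodies of all stages. -/
def StageSpace (G : Omega1 → Stage) : Type 1 :=
  {p : Omega1 × Cantor // p.2 ∈ (G p.1).body}

namespace StageSpace

variable {G : Omega1 → Stage}

/-- The stage to which a point belongs. -/
def rank (p : StageSpace G) : Omega1 := p.1.1

/-- The basic open sets. -/
def box (G : Omega1 → Stage) (V : Clopens Cantor) (H : Finset Omega1) : Set (StageSpace G) :=
  {p | p.1.2 ∈ V ∧ ∀ γ ∈ H, p.rank ≤ γ ∨ γ ∈ (G p.rank).nbr}

theorem box_inter_box (V V' : Clopens Cantor) (H H' : Finset Omega1) :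
    box G V H ∩ box G V' H' = box G (V ⊓ V') (H ∪ H') := by
  ext p
  constructor
  · rintro ⟨⟨h1, h2⟩, h3, h4⟩
    refine ⟨⟨h1, h3⟩, fun γ hγ => ?_⟩
    rcases Finset.mem_union.1 hγ with hγ | hγ
    exacts [h2 γ hγ, h4 γ hγ]
  · rintro ⟨⟨h1, h3⟩, h⟩
    exact ⟨⟨h1, fun γ hγ => h γ (Finset.mem_union_left _ hγ)⟩, h3,
      fun γ hγ => h γ (Finset.mem_union_right _ hγ)⟩

instance : TopologicalSpace (StageSpace G) where
  IsOpen O := ∀ p ∈ O, ∃ V H, p ∈ box G V H ∧ box G V H ⊆ O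
  isOpen_univ := fun p _ => ⟨⊤, ∅, ⟨trivial, by simp⟩, Set.subset_univ _⟩
  isOpen_inter := by
    rintro O O' hO hO' p ⟨hp, hp'⟩
    obtain ⟨V, H, h1, h2⟩ := hO p hp
    obtain ⟨V', H', h3, h4⟩ := hO' p hp'
    refine ⟨V ⊓ V', H ∪ H', ?_⟩
    rw [← box_inter_box]
    exact ⟨⟨h1, h3⟩, Set.inter_subset_inter h2 h4⟩
  isOpen_sUnion := by
    rintro s hs p ⟨O, hO, hp⟩
    obtain ⟨V, H, h1, h2⟩ := hs O hO p hp
    exact ⟨V, H, h1, h2.trans (Set.subset_sUnion_of_mem hO)⟩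

theorem isOpen_iff {O : Set (StageSpace G)} :
    IsOpen O ↔ ∀ p ∈ O, ∃ V H, p ∈ box G V H ∧ box G V H ⊆ O := Iff.rfl

theorem isOpen_box (V : Clopens Cantor) (H : Finset Omega1) : IsOpen (box G V H) :=
  isOpen_iff.2 fun _ hp => ⟨V, H, hp, subset_rfl⟩

theorem t2Space (hdis : ∀ p q, p ≠ q → Disjoint (G p).body (G q).body) :
    T2Space (StageSpace G) := by
  refine ⟨fun p q hpq => ?_⟩
  have hne : p.1.2 ≠ q.1.2 := fun h => by
    by_cases hr : p.1.1 = q.1.1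
    · exact hpq (Subtype.ext (Prod.ext hr h))
    · exact Set.disjoint_left.1 (hdis _ _ hr) p.2 (h ▸ q.2)
  obtain ⟨W, hpW, hW⟩ := Clopens.exists_between (isClosed_singleton (x := p.1.2))
    (isOpen_compl_singleton (x := q.1.2)) (by simpa using Ne.symm hne)
  refine ⟨box G W ∅, box G Wᶜ ∅, isOpen_box _ _, isOpen_box _ _, ⟨hpW rfl, by simp⟩,
    ⟨fun h => hW h rfl, by simp⟩, Set.disjoint_left.2 fun x hx hx' => hx'.1 hx.1⟩

theorem exists_lt_forall_mem_box (hG : CapturesFamilies G)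
    (K : Omega1 → Finset (StageSpace G)) (V : Omega1 → StageSpace G → Clopens Cantor)
    (H : Omega1 → StageSpace G → Finset Omega1) (h : ∀ i, ∀ p ∈ K i, p ∈ box G (V i p) (H i p)) :
    ∃ i j, i < j ∧ ∀ q ∈ K j, ∃ p ∈ K i, q ∈ box G (V i p) (H i p) := by
  classical
  obtain ⟨S₁, -, hS₁, R, -, hR⟩ := exists_deltaSystem Omega1.not_countable_univ
    fun i => (K i).biUnion (H i)
  obtain ⟨S₂, hS₂₁, hS₂, Q, -, hQ⟩ := exists_deltaSystem hS₁ fun i => (K i).image rank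
  obtain ⟨t, hS₃⟩ := Set.exists_not_countable_fiber hS₂ fun i => (K i).image fun p =>
    ((V i p, (fun r => r.1 ∈ H i p), (fun a => p.rank = a.1)) :
      Clopens Cantor × (R → Prop) × (Q → Prop))
  obtain ⟨α, S₀, hS₀, hc, hcap⟩ := hG.exists_countable hS₃
    (hR.subset fun i hi => hS₂₁ hi.1)
  obtain ⟨b, hb⟩ := Omega1.exists_gt_of_countable_s5 hc
  obtain ⟨j, ⟨⟨hj₂, hjt⟩, hjα⟩, hjb⟩ : ((_ \ _) \ Set.Iic b).Nonempty := by
    rw [Set.nonempty_iff_ne_empty]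
    intro h
    refine Set.not_countable_diff (Set.not_countable_diff hS₃
      (Set.Countable.setOf_not_disjoint hQ (Omega1.countable_Iic α)))
      (Omega1.countable_Iic b) (h ▸ Set.countable_empty)
  obtain ⟨i, hi, hcom⟩ := hcap ((K j).image rank \ Q) fun p hp =>
    not_le.1 fun hle => hjα ⟨hj₂, p, hp, hle⟩
  refine ⟨i, j, (hb i hi).trans (not_le.1 hjb), fun q hq => ?_⟩
  have hqt := Finset.mem_image_of_mem (fun p =>
    ((V j p, (fun r => r.1 ∈ H j p), (fun a => p.rank = a.1)) :
      Clopens Cantor × (R → Prop) × (Q → Prop))) hq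
  rw [hjt, ← (hS₀ hi).2, Finset.mem_image] at hqt
  obtain ⟨p, hp, hpq⟩ := hqt
  simp only [Prod.mk.injEq] at hpq
  obtain ⟨hV, hRpq, hQpq⟩ := hpq
  refine ⟨p, hp, hV ▸ (h j q hq).1, fun γ hγ => ?_⟩
  by_cases hγR : γ ∈ R
  · exact (h j q hq).2 γ (((congrFun hRpq ⟨γ, hγR⟩).to_iff).1 hγ)
  by_cases hqQ : q.rank ∈ Q
  · have : p.rank = q.rank := ((congrFun hQpq ⟨_, hqQ⟩).to_iff).2 rfl
    rw [← this]
    exact (h i p hp).2 γ hγ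
  · exact Or.inr (hcom _ (Finset.mem_sdiff.2 ⟨Finset.mem_image_of_mem _ hq, hqQ⟩) γ
      (Finset.mem_sdiff.2 ⟨Finset.mem_biUnion.2 ⟨p, hp, hγ⟩, hγR⟩))

theorem isEpsilonSpace (hG : CapturesFamilies G) (Y : Set (StageSpace G)) :
    IsEpsilonSpace Y := by
  classical
  intro 𝒰 hopen hcov
  by_contra! hno
  obtain ⟨f, hf⟩ := Omega1.exists_seq
    (T := {x : Finset Y × Set Y // x.2 ∈ 𝒰 ∧ (x.1 : Set Y) ⊆ x.2})
    (fun x y => ¬ (y.1.1 : Set Y) ⊆ x.1.2) (by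
      intro s hs
      obtain ⟨K, hK⟩ := hno ((fun x => x.1.2) '' s) (by
        rintro _ ⟨x, -, rfl⟩
        exact x.2.1) (hs.image _)
      obtain ⟨U, hU, hKU⟩ := hcov K
      exact ⟨⟨(K, U), hU, hKU⟩, fun y hy => hK _ ⟨y, hy, rfl⟩⟩)
  have hO (i : Omega1) := isOpen_induced_iff.1 (hopen _ (f i).2.1)
  choose O hO hOU using hO
  have hbox (i : Omega1) (p : StageSpace G) : p ∈ (f i).1.1.image Subtype.val →
      ∃ V H, p ∈ box G V H ∧ box G V H ⊆ O i := by
    intro hp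
    obtain ⟨y, hy, rfl⟩ := Finset.mem_image.1 hp
    refine isOpen_iff.1 (hO i) y.1 ?_
    have := (f i).2.2 hy
    rwa [← hOU i] at this
  choose! V H h1 h2 using hbox
  obtain ⟨i, j, hij, h⟩ := exists_lt_forall_mem_box hG _ V H h1
  refine hf i j hij fun y hy => ?_
  obtain ⟨p, hp, hyp⟩ := h y.1 (Finset.mem_image_of_mem _ hy)
  rw [← hOU i]
  exact h2 i p hp hyp

theorem hereditarilyLindelofSpace (hG : CapturesFamilies G) :
    HereditarilyLindelofSpace (StageSpace G) :=
  ⟨fun Y _ => isLindelof_iff_lindelofSpace.2 (isEpsilonSpace hG Y).lindelofSpace⟩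

theorem isTame_rank_image {A : Omega1 → Set Omega1} {𝓕 : Omega1 → Set (Finset Omega1)}
    (hG : ∀ β, IsGoodStage A 𝓕 β (fun γ _ => G γ) (G β)) {D : Set (StageSpace G)}
    (hcl : IsClosed D) (hdisc : DiscreteTopology D) (β : Omega1) :
    IsTame β (fun γ _ => G γ) (rank '' D) := by
  classical
  intro α hα
  have hloc (z : Cantor) : z ∈ (G α).body → ∃ (V : Clopens Cantor) (H : Finset Omega1), z ∈ V ∧
      (∀ γ ∈ H, α ≤ γ ∨ γ ∈ (G α).nbr) ∧ ∀ y ∈ D, y.rank < α → y ∉ box G V H := by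
    intro hz
    let x : StageSpace G := ⟨(α, z), hz⟩
    have hW := hcl.isClosedEmbedding_subtypeVal.isClosedMap _
      (isClosed_discrete {y : D | y.1 ≠ x})
    obtain ⟨V, H, hx, hVH⟩ := isOpen_iff.1 hW.isOpen_compl x (by
      rintro ⟨y, hy, hyx⟩
      exact hy hyx)
    refine ⟨V, H, hx.1, hx.2, fun y hy hlt hbox => hVH hbox ⟨⟨y, hy⟩, ?_, rfl⟩⟩
    rintro rfl
    exact lt_irrefl _ hlt
  choose! V H h1 h2 h3 using hloc
  obtain ⟨t, ht, htc⟩ := (hG α).closed.isCompact.elim_nhds_subcover (fun z => (V z : Set Cantor))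
    fun z hz => (V z).isClopen.isOpen.mem_nhds (h1 z hz)
  obtain ⟨V₀, hV₀, hsub⟩ := Clopens.exists_between (hG α).closed
    (isOpen_biUnion fun z (_ : z ∈ t) => (V z).isClopen.isOpen) htc
  refine ⟨V₀, (t.biUnion H).filter (· < α), hV₀, fun γ hγ => ?_, ?_⟩
  · obtain ⟨hγ, hγα⟩ := Finset.mem_filter.1 hγ
    obtain ⟨z, hz, hγz⟩ := Finset.mem_biUnion.1 hγ
    exact ⟨hγα, (h2 z (ht z hz) γ hγz).resolve_left (not_le.2 hγα)⟩
  · rintro _ ⟨y, hy, rfl⟩ hyα hbox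
    obtain ⟨z, hz, hyz⟩ := Set.mem_iUnion₂.1 (hsub (hbox.1 y.2))
    refine h3 z (ht z hz) y hy hyα ⟨hyz, fun γ hγ => ?_⟩
    by_cases hγα : γ < α
    · exact hbox.2 γ (Finset.mem_filter.2 ⟨Finset.mem_biUnion.2 ⟨z, hz, hγ⟩, hγα⟩)
    · exact Or.inl (hyα.le.trans (not_lt.1 hγα))

theorem not_isDSpace [HereditarilyLindelofSpace (StageSpace G)] {A : Omega1 → Set Omega1}
    {𝓕 : Omega1 → Set (Finset Omega1)}
    (hG : ∀ β, IsGoodStage A 𝓕 β (fun γ _ => G γ) (G β))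
    (hA : ∀ B : Set Omega1, IsStationaryIn {α | B ∩ {β | β < α} = A α}) :
    ¬ IsDSpace (StageSpace G) := by
  intro hD
  obtain ⟨D, hcl, hdisc, hcov⟩ := hD (fun p => box G ⊤ {p.rank}) fun p =>
    ⟨isOpen_box _ _, trivial, by simp⟩
  have hc : D.Countable := (HereditarilyLindelofSpace.isLindelof D).countable hdisc
  obtain ⟨δ, hδ⟩ := Omega1.exists_gt_of_countable_s5 (hc.image rank)
  have hclub : IsClubIn (Set.Ioi δ) := by
    refine ⟨fun a => ?_, ?_⟩
    · obtain ⟨c, hc⟩ := exists_gt (max a δ)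
      exact ⟨c, (le_max_right _ _).trans_lt hc, (le_max_left _ _).trans_lt hc⟩
    · rintro a ⟨b, hb⟩ h
      obtain ⟨c, hc, -, hca⟩ := h b hb
      exact lt_trans hc hca
  obtain ⟨β, hβA, hβ⟩ := hA (rank '' D) _ hclub
  have hAβ : A β = rank '' D := by
    rw [← show _ = A β from hβA]
    exact Set.inter_eq_left.2 fun γ hγ => (hδ γ hγ).trans hβ
  have havoid := (hG β).avoid (hAβ ▸ isTame_rank_image hG hcl hdisc β)
  obtain ⟨x, hx⟩ := (hG β).nonempty
  have hp : (⟨(β, x), hx⟩ : StageSpace G) ∈ ⋃ p ∈ D, box G ⊤ {p.rank} := hcov ▸ trivial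
  obtain ⟨y, hy, -, hyp⟩ := Set.mem_iUnion₂.1 hp
  have hyr : y.rank ∈ rank '' D := ⟨y, hy, rfl⟩
  rcases hyp y.rank (Finset.mem_singleton_self _) with h | h
  · exact lt_irrefl _ ((h.trans_lt (hδ _ hyr)).trans hβ)
  · exact havoid _ h (hAβ ▸ hyr)

end StageSpace

end

/-- Assuming `◊`, there is a Hausdorff hereditarily Lindelöf space that is not a
`D`-space and all of whose subspaces are `(ε)`-spaces. -/
theorem statement5 (hd : DiamondPrinciple) :
    ∃ (X : Type 1) (τ : TopologicalSpace X),
      @T2Space X τ ∧ @HereditarilyLindelofSpace X τ ∧ ¬ @IsDSpace X τ ∧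
      ∀ Y : Set X,
        @IsEpsilonSpace Y (TopologicalSpace.induced (Subtype.val : Y → X) τ) := by
  obtain ⟨A, -, hA⟩ := hd
  have : Infinite Omega1 := ⟨fun h => Omega1.not_countable_univ Set.finite_univ.countable⟩
  obtain ⟨e⟩ : Nonempty (Omega1 ≃ Finset Omega1) :=
    Cardinal.eq.1 (Cardinal.mk_finset_of_infinite Omega1).symm
  obtain ⟨G, hG⟩ := exists_forall_isGoodStage A (fun α => {F | e.symm F ∈ A α ∧ ∀ p ∈ F, p < α})
    fun α F hF => hF.2
  have hcap : CapturesFamilies G := fun 𝒢 h1 h2 h3 =>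
    exists_forall_exists_subset_nbr hG e hA (fun _ _ => Iff.rfl) h1 h2 h3
  have hL := StageSpace.hereditarilyLindelofSpace hcap
  exact ⟨StageSpace G, inferInstance, StageSpace.t2Space fun _ _ => disjoint_body hG, hL,
    StageSpace.not_isDSpace hG hA, StageSpace.isEpsilonSpace hcap⟩
end
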